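/- A map of simplicial sets is a trivial fibration if and only if it is both a Kan fibration and a weak homotopy equivalence. -/

import Mathlib

open CategoryTheory CategoryTheory.Limits Simplicial MonoidalCategory SSet

noncomputable instance : MonoidalClosed SSet.{0} :=
  (inferInstance : MonoidalClosed (SimplexCategoryᵒᵖ ⥤ Type 0))

namespace Paper

/-- A map of simplicial sets is a *trivial fibration* if it has the right lifting
property with respect to all boundary inclusions `∂Δ[n] ⟶ Δ[n]` for `n ≥ 0`. -/
def TrivialFibration {X Y : SSet.{0}} (p : X ⟶ Y) : Prop :=
  ∀ n : ℕ, HasLiftingProperty (SSet.boundary n).ι p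

/-- A map of simplicial sets is a *Kan fibration* if it has the right lifting property
with respect to all horn inclusions `Λ[n, i] ⟶ Δ[n]` for `n ≥ 1`, `0 ≤ i ≤ n`. -/
def KanFibration {X Y : SSet.{0}} (p : X ⟶ Y) : Prop :=
  ∀ (n : ℕ) (i : Fin (n + 2)), HasLiftingProperty (SSet.horn (n + 1) i).ι p

/-- An *anodyne* map is one with the left lifting property with respect to
all Kan fibrations. -/
def Anodyne {A B : SSet.{0}} (i : A ⟶ B) : Prop :=
  ∀ ⦃X Y : SSet.{0}⦄ (p : X ⟶ Y), KanFibration p → HasLiftingProperty i p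

/-- The unique map to `Δ[0]`. -/
def toPt (X : SSet.{0}) : X ⟶ Δ[0] where
  app m := ↾fun _ => SSet.stdSimplex.const 0 0 m
  naturality := by
    intro m m' φ
    refine ConcreteCategory.hom_ext _ _ fun x => ?_
    apply stdSimplex.objEquiv.injective
    apply SimplexCategory.Hom.ext
    apply OrderHom.ext
    funext j
    exact @Subsingleton.elim (Fin 1) _ _ _

/-- A *Kan complex* is a simplicial set whose map to `Δ[0]` is a Kan fibration. -/
def KanComplex (X : SSet.{0}) : Prop :=
  KanFibration (toPt X)

/-- The constant map at the vertex `k` of `Δ[1]`. -/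
def cst (X : SSet.{0}) (k : Fin 2) : X ⟶ Δ[1] where
  app m := ↾fun _ => SSet.stdSimplex.const 1 k m
  naturality := by
    intro m m' φ
    refine ConcreteCategory.hom_ext _ _ fun x => ?_
    apply stdSimplex.objEquiv.injective
    apply SimplexCategory.Hom.ext
    ext j
    rfl

/-- The endpoint inclusion `X ⟶ X ⊗ Δ[1]` at the vertex `k` of `Δ[1]`. -/
noncomputable def ept (X : SSet.{0}) (k : Fin 2) : X ⟶ X ⊗ Δ[1] :=
  CartesianMonoidalCategory.lift (𝟙 X) (cst X k)

/-- A (single-step) homotopy from `f` to `g`, as a property of the pair `(f, g)`. -/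
def Homotopy {X Y : SSet.{0}} (f g : X ⟶ Y) : Prop :=
  ∃ H : X ⊗ Δ[1] ⟶ Y, ept X 0 ≫ H = f ∧ ept X 1 ≫ H = g

/-- `f` and `g` are *homotopic* if they are connected by a zig-zag of homotopies. -/
def Homotopic {X Y : SSet.{0}} (f g : X ⟶ Y) : Prop :=
  Relation.EqvGen Homotopy f g

/-- A *homotopy equivalence* of simplicial sets. -/
def HomotopyEquivalence {X Y : SSet.{0}} (f : X ⟶ Y) : Prop :=
  ∃ g : Y ⟶ X, Homotopic (f ≫ g) (𝟙 X) ∧ Homotopic (g ≫ f) (𝟙 Y)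

/-- A map `f : X ⟶ Y` is a *weak homotopy equivalence* if for every Kan complex `K`
the induced map `K^Y ⟶ K^X` on exponentials is a homotopy equivalence. -/
def WeakHomotopyEquivalence {X Y : SSet.{0}} (f : X ⟶ Y) : Prop :=
  ∀ K : SSet.{0}, KanComplex K → HomotopyEquivalence ((MonoidalClosed.pre f).app K)

/-- A homotopy `H` between maps over `B` which is *fiberwise over `B`*. -/
def FibHomotopy {B X Y : SSet.{0}} (pX : X ⟶ B) (pY : Y ⟶ B) (f g : X ⟶ Y) : Prop :=
  ∃ H : X ⊗ Δ[1] ⟶ Y, ept X 0 ≫ H = f ∧ ept X 1 ≫ H = g ∧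
    H ≫ pY = CartesianMonoidalCategory.fst X Δ[1] ≫ pX

/-- Connectedness by a zig-zag of fiberwise homotopies over `B`. -/
def FibHomotopic {B X Y : SSet.{0}} (pX : X ⟶ B) (pY : Y ⟶ B) (f g : X ⟶ Y) : Prop :=
  Relation.EqvGen (FibHomotopy pX pY) f g

/-- A *fiberwise homotopy equivalence over `B`*. -/
def FibHomotopyEquivalence {B X Y : SSet.{0}} (pX : X ⟶ B) (pY : Y ⟶ B) (f : X ⟶ Y) : Prop :=
  f ≫ pY = pX ∧ ∃ g : Y ⟶ X, g ≫ pX = pY ∧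
    FibHomotopic pX pX (f ≫ g) (𝟙 X) ∧ FibHomotopic pY pY (g ≫ f) (𝟙 Y)

end Paper

namespace Paper

section Bridge

open HomotopicalAlgebra SSet.modelCategoryQuillen

theorem kanFibration_iff_fibration {X Y : SSet.{0}} (p : X ⟶ Y) :
    KanFibration p ↔ Fibration p := by
  rw [fibration_iff]
  constructor
  · intro h A B f hf
    simp only [J, MorphismProperty.iSup_iff] at hf
    obtain ⟨n, ⟨i⟩⟩ := hf
    exact h n i
  · intro h n i
    exact h _ (horn_ι_mem_J (n + 1) i)

theorem trivialFibration_iff_rlp {X Y : SSet.{0}} (p : X ⟶ Y) :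
    TrivialFibration p ↔ (MorphismProperty.monomorphisms SSet.{0}).rlp p := by
  rw [SSet.rlp_monomorphisms]
  constructor
  · rintro h A B f ⟨n⟩
    exact h n
  · intro h n
    exact h _ ⟨n⟩

theorem TrivialFibration.hasLiftingProperty {X Y : SSet.{0}} {p : X ⟶ Y}
    (hp : TrivialFibration p) {A B : SSet.{0}} (i : A ⟶ B) [Mono i] :
    HasLiftingProperty i p :=
  (trivialFibration_iff_rlp p).1 hp i (MorphismProperty.monomorphisms.infer_property i)

theorem KanFibration.hasLiftingProperty {X Y : SSet.{0}} {p : X ⟶ Y}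
    (hp : KanFibration p) {A B : SSet.{0}} {i : A ⟶ B} (hi : anodyneExtensions i) :
    HasLiftingProperty i p :=
  hi p ((kanFibration_iff_fibration p).1 hp |>.mem)

theorem toPt_unique {X : SSet.{0}} (f g : X ⟶ Δ[0]) : f = g :=
  stdSimplex.ext₀

def isTerminalPt : IsTerminal (Δ[0] : SSet.{0}) :=
  IsTerminal.ofUniqueHom (fun X => toPt X) (fun _ _ => toPt_unique _ _)

theorem kanComplex_iff (X : SSet.{0}) : KanComplex X ↔ SSet.KanComplex X := by
  unfold KanComplex
  rw [kanFibration_iff_fibration]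
  exact (isFibrant_iff_of_isTerminal (toPt X) isTerminalPt).symm

theorem kanFibration_pre {A B : SSet.{0}} (i : A ⟶ B) [Mono i] {K : SSet.{0}} (hK : KanComplex K) :
    KanFibration ((MonoidalClosed.pre i).app K) := by
  rw [kanFibration_iff_fibration]
  have := (kanComplex_iff K).1 hK
  infer_instance

theorem kanComplex_ihom (A : SSet.{0}) {K : SSet.{0}} (hK : KanComplex K) :
    KanComplex ((ihom A).obj K) := by
  rw [kanComplex_iff] at hK ⊢
  infer_instance

theorem KanFibration.comp {X Y Z : SSet.{0}} {p : X ⟶ Y} {q : Y ⟶ Z} (hp : KanFibration p)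
    (hq : KanFibration q) : KanFibration (p ≫ q) := fun n i => by
  have := hp n i
  have := hq n i
  infer_instance

theorem KanFibration.of_isIso {X Y : SSet.{0}} (p : X ⟶ Y) [IsIso p] : KanFibration p :=
  fun _ _ => inferInstance

theorem KanFibration.kanComplex {X Y : SSet.{0}} {p : X ⟶ Y} (hp : KanFibration p)
    (hY : KanComplex Y) : KanComplex X := by
  have := hp.comp hY
  rwa [toPt_unique (p ≫ toPt Y) (toPt X)] at this

end Bridge

section Elements

variable {X Y Z : SSet.{0}}

theorem hom_ext_app {f g : X ⟶ Y} (h : ∀ m (x : X.obj m), f.app m x = g.app m x) : f = g :=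
  NatTrans.ext (funext fun m => ConcreteCategory.hom_ext _ _ (h m))

theorem app_congr {f g : X ⟶ Y} (h : f = g) {m : SimplexCategoryᵒᵖ} (x : X.obj m) :
    f.app m x = g.app m x := by rw [h]

theorem app_map (f : X ⟶ Y) {m l : SimplexCategoryᵒᵖ} (φ : m ⟶ l) (x : X.obj m) :
    f.app l (X.map φ x) = Y.map φ (f.app m x) :=
  NatTrans.naturality_apply f φ x

theorem map_id_apply (X : SSet.{0}) {m : SimplexCategoryᵒᵖ} (x : X.obj m) :
    X.map (𝟙 m) x = x := by simp

theorem map_comp_apply (X : SSet.{0}) {m l k : SimplexCategoryᵒᵖ} (φ : m ⟶ l) (ψ : l ⟶ k)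
    (x : X.obj m) : X.map (φ ≫ ψ) x = X.map ψ (X.map φ x) := by simp

theorem comp_app_apply (f : X ⟶ Y) (g : Y ⟶ Z) {m : SimplexCategoryᵒᵖ} (x : X.obj m) :
    (f ≫ g).app m x = g.app m (f.app m x) := rfl

/-- A map of simplicial sets given by a natural family of functions. -/
def homMk (φ : ∀ m, X.obj m → Y.obj m)
    (h : ∀ {m l : SimplexCategoryᵒᵖ} (f : m ⟶ l) (x : X.obj m),
      φ l (X.map f x) = Y.map f (φ m x)) : X ⟶ Y where
  app m := ↾(φ m)
  naturality _ _ f := ConcreteCategory.hom_ext _ _ fun x => h f x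

/-- The simplex of a product with given components. -/
def pair {m : SimplexCategoryᵒᵖ} (x : X.obj m) (y : Y.obj m) : (X ⊗ Y).obj m := (x, y)

theorem exists_pair {m : SimplexCategoryᵒᵖ} (z : (X ⊗ Y).obj m) :
    ∃ x y, z = pair (X := X) (Y := Y) x y := ⟨z.1, z.2, rfl⟩

theorem pair_inj {m : SimplexCategoryᵒᵖ} {x x' : X.obj m} {y y' : Y.obj m} :
    pair x y = pair x' y' ↔ x = x' ∧ y = y' := Prod.mk_inj

theorem pair_map {m l : SimplexCategoryᵒᵖ} (f : m ⟶ l) (x : X.obj m) (y : Y.obj m) :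
    (X ⊗ Y).map f (pair x y) = pair (X.map f x) (Y.map f y) := rfl

theorem whiskerRight_pair (f : X ⟶ Y) {m : SimplexCategoryᵒᵖ} (x : X.obj m) (z : Z.obj m) :
    (f ▷ Z).app m (pair x z) = pair (f.app m x) z := rfl

theorem ept_app (k : Fin 2) {m : SimplexCategoryᵒᵖ} (x : X.obj m) :
    (ept X k).app m x = pair x (stdSimplex.const 1 k m) := rfl

theorem ept_whiskerRight_assoc (f : X ⟶ Y) (k : Fin 2) (g : Y ⊗ Δ[1] ⟶ Z) :
    ept X k ≫ f ▷ Δ[1] ≫ g = f ≫ ept Y k ≫ g := rfl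

theorem ept_fst (k : Fin 2) : ept X k ≫ CartesianMonoidalCategory.fst X Δ[1] = 𝟙 X := rfl

theorem ept_fst_assoc (k : Fin 2) (g : X ⟶ Y) :
    ept X k ≫ CartesianMonoidalCategory.fst X Δ[1] ≫ g = g := rfl

theorem mono_of_injective {f : X ⟶ Y} (h : ∀ m, Function.Injective (f.app m)) : Mono f := by
  refine ⟨fun u v huv => hom_ext_app fun m x => h m ?_⟩
  exact app_congr huv x

theorem injective_of_mono (f : X ⟶ Y) [Mono f] {m : SimplexCategoryᵒᵖ} {x y : X.obj m}
    (h : f.app m x = f.app m y) : x = y := by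
  have : Mono (f.app m) := inferInstance
  exact (mono_iff_injective (f.app m)).1 this h

instance mono_ept (k : Fin 2) : Mono (ept X k) :=
  mono_of_injective fun _ _ _ h => congrArg Prod.fst h

instance mono_whiskerRight (f : X ⟶ Y) [Mono f] : Mono (f ▷ Z) :=
  mono_of_injective fun m a b h => by
    obtain ⟨x, y, rfl⟩ := exists_pair a
    obtain ⟨x', y', rfl⟩ := exists_pair b
    rw [whiskerRight_pair, whiskerRight_pair, pair_inj] at h
    exact pair_inj.2 ⟨injective_of_mono f h.1, h.2⟩

theorem const_zero_ne_one (m : SimplexCategoryᵒᵖ) :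
    stdSimplex.const 1 0 m ≠ (stdSimplex.const 1 1 m : (Δ[1] : SSet.{0}).obj m) := by
  intro h
  have h' : (0 : Fin 2) = 1 := congrArg (fun z => stdSimplex.asOrderHom z 0) h
  exact absurd h' (by decide)

theorem eq_const_of_mem_horn_one {k : Fin 2} {m : SimplexCategoryᵒᵖ}
    {t : (Δ[1] : SSet.{0}).obj m} (h : t ∈ (horn 1 k).obj m) : t = stdSimplex.const 1 k m := by
  rw [mem_horn_iff] at h
  apply stdSimplex.objEquiv.injective
  apply SimplexCategory.Hom.ext
  apply OrderHom.ext
  funext j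
  by_contra hne
  apply h
  rw [Set.eq_univ_iff_forall]
  intro a
  by_cases ha : a = k
  · exact Or.inr ha
  · refine Or.inl ⟨j, ?_⟩
    have h2 : ∀ a b k : Fin 2, a ≠ k → b ≠ k → b = a := by decide
    exact h2 _ _ k ha hne

theorem const_mem_horn_one (k : Fin 2) (m : SimplexCategoryᵒᵖ) :
    (stdSimplex.const 1 k m : (Δ[1] : SSet.{0}).obj m) ∈ (horn 1 k).obj m := by
  rw [mem_horn_iff]
  intro h
  have h2 : ∀ k : Fin 2, ∃ a, a ≠ k := by decide
  obtain ⟨a, ha⟩ := h2 k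
  rcases (Set.eq_univ_iff_forall.1 h) a with ⟨j, hj⟩ | h'
  · exact ha hj.symm
  · exact ha h'

end Elements

section Glue

/-- The union of the ranges of a family of maps. -/
def unionRange {ι : Type} {M : ι → SSet.{0}} {T : SSet.{0}} (i : ∀ a, M a ⟶ T) :
    T.Subcomplex where
  obj m := {x | ∃ a y, (i a).app m y = x}
  map := by
    rintro m l f _ ⟨a, y, rfl⟩
    exact ⟨a, (M a).map f y, app_map _ _ _⟩

theorem exists_glue {ι : Type} {M : ι → SSet.{0}} {T E : SSet.{0}} (i : ∀ a, M a ⟶ T)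
    (f : ∀ a, M a ⟶ E) (A : T.Subcomplex) (hA : A ≤ unionRange i)
    (compat : ∀ a b m (x : (M a).obj m) (y : (M b).obj m), (i a).app m x = (i b).app m y →
      (f a).app m x = (f b).app m y) :
    ∃ g : A.toSSet ⟶ E, ∀ a m (x : (M a).obj m) (h : (i a).app m x ∈ A.obj m),
      g.app m ⟨_, h⟩ = (f a).app m x := by
  have H : ∀ m (z : A.toSSet.obj m), ∃ e : E.obj m, ∀ a (x : (M a).obj m),
      (i a).app m x = z.1 → e = (f a).app m x := by
    rintro m ⟨z, hz⟩
    obtain ⟨a, y, rfl⟩ := hA m hz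
    exact ⟨(f a).app m y, fun b x hx => compat _ _ _ _ _ hx.symm⟩
  choose φ hφ using H
  refine ⟨homMk φ ?_, fun a m x h => hφ m ⟨_, h⟩ a x rfl⟩
  rintro m l g ⟨z, hz⟩
  obtain ⟨a, y, rfl⟩ := hA m hz
  rw [hφ m ⟨_, hz⟩ a y rfl, ← app_map]
  exact hφ l _ a _ (app_map _ _ _)

end Glue

section Lift

variable {E B : SSet.{0}} {q : E ⟶ B}

theorem anodyne_horn_one (k : Fin 2) : anodyneExtensions (horn.{0} 1 k).ι :=
  anodyneExtensions.horn_ι k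

/-- Relative homotopy lifting: a homotopy in the base starting at the image of `u` lifts,
extending given lifts on a compatible family of subobjects. -/
theorem KanFibration.exists_lift_homotopy (hq : KanFibration q) (k : Fin 2) {ι : Type}
    {M : ι → SSet.{0}} {N : SSet.{0}} (i : ∀ a, M a ⟶ N) (u : N ⟶ E)
    (h : ∀ a, M a ⊗ Δ[1] ⟶ E) (b : N ⊗ Δ[1] ⟶ B)
    (compat : ∀ a c m (x : (M a).obj m) (y : (M c).obj m), (i a).app m x = (i c).app m y →
      ∀ t, (h a).app m (pair x t) = (h c).app m (pair y t))
    (hu : ∀ a, ept (M a) k ≫ h a = i a ≫ u) (hub : ept N k ≫ b = u ≫ q)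
    (hb : ∀ a, h a ≫ q = i a ▷ Δ[1] ≫ b) :
    ∃ l : N ⊗ Δ[1] ⟶ E, ept N k ≫ l = u ∧ (∀ a, i a ▷ Δ[1] ≫ l = h a) ∧ l ≫ q = b := by
  let M' : Option ι → SSet.{0} := fun o => o.elim N fun a => M a ⊗ Δ[1]
  let i' : ∀ o, M' o ⟶ N ⊗ Δ[1] := fun o => match o with
    | none => ept N k
    | some a => i a ▷ Δ[1]
  let f' : ∀ o, M' o ⟶ E := fun o => match o with
    | none => u
    | some a => h a
  let U := (unionRange i).unionProd (horn 1 k)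
  have key : ∀ a m (x : (M a).obj m) (t : (Δ[1] : SSet.{0}).obj m) (y : N.obj m),
      pair ((i a).app m x) t = pair y (stdSimplex.const 1 k m) →
      (h a).app m (pair x t) = u.app m y := by
    intro a m x t y hxy
    obtain ⟨rfl, rfl⟩ := pair_inj.1 hxy
    exact app_congr (hu a) x
  obtain ⟨g, hg⟩ := exists_glue i' f' U (by
    rintro m ⟨x, t⟩ hx
    rcases (Subcomplex.mem_unionProd_iff _ _ _).1 hx with ht | ⟨a, y, hy⟩
    · refine ⟨none, x, ?_⟩
      have := eq_const_of_mem_horn_one ht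
      exact pair_inj.2 ⟨rfl, this.symm⟩
    · exact ⟨some a, pair y t, pair_inj.2 ⟨hy, rfl⟩⟩) (by
    rintro (_ | a) (_ | c) m x y hxy
    · exact congrArg _ (congrArg Prod.fst hxy)
    · obtain ⟨y, t, rfl⟩ := exists_pair y
      exact (key c m y t x hxy.symm).symm
    · obtain ⟨x, t, rfl⟩ := exists_pair x
      exact key a m x t y hxy
    · obtain ⟨x, t, rfl⟩ := exists_pair x
      obtain ⟨y, t', rfl⟩ := exists_pair y
      obtain ⟨h1, rfl⟩ := pair_inj.1 hxy
      exact compat a c m x y h1 t)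
  have memN : ∀ m (x : N.obj m), (ept N k).app m x ∈ U.obj m := fun m x =>
    (Subcomplex.mem_unionProd_iff _ _ _).2 (Or.inl (const_mem_horn_one k m))
  have memM : ∀ a m (z : (M a ⊗ Δ[1]).obj m), (i a ▷ Δ[1]).app m z ∈ U.obj m := fun a m z =>
    (Subcomplex.mem_unionProd_iff _ _ _).2 (Or.inr ⟨a, z.1, rfl⟩)
  have sq : CommSq g U.ι q b := ⟨by
    refine hom_ext_app ?_
    rintro m ⟨⟨x, t⟩, hx⟩
    rcases (Subcomplex.mem_unionProd_iff _ _ _).1 hx with ht | ⟨a, y, hy⟩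
    · have ht' : t = stdSimplex.const 1 k m := eq_const_of_mem_horn_one ht
      subst ht'
      exact (congrArg (q.app m) (hg none m x hx)).trans (app_congr hub x).symm
    · change (i a).app m y = x at hy
      subst hy
      exact (congrArg (q.app m) (hg (some a) m (pair y t) hx)).trans
        (app_congr (hb a) (pair y t))⟩
  have := hq.hasLiftingProperty
    (anodyneExtensions_unionProd_ι (unionRange i) (horn 1 k) (anodyne_horn_one k))
  refine ⟨sq.lift, ?_, fun a => ?_, sq.fac_right⟩
  · refine hom_ext_app fun m x => ?_
    have := app_congr sq.fac_left ⟨_, memN m x⟩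
    exact this.trans (hg none m x _)
  · refine hom_ext_app fun m x => ?_
    have := app_congr sq.fac_left ⟨_, memM a m x⟩
    exact this.trans (hg (some a) m x _)

/-- Relative homotopy lifting along a monomorphism. -/
theorem KanFibration.exists_lift_homotopy_mono (hq : KanFibration q) (k : Fin 2)
    {M N : SSet.{0}} (i : M ⟶ N) [Mono i] (u : N ⟶ E) (h : M ⊗ Δ[1] ⟶ E) (b : N ⊗ Δ[1] ⟶ B)
    (hu : ept M k ≫ h = i ≫ u) (hub : ept N k ≫ b = u ≫ q) (hb : h ≫ q = i ▷ Δ[1] ≫ b) :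
    ∃ l : N ⊗ Δ[1] ⟶ E, ept N k ≫ l = u ∧ i ▷ Δ[1] ≫ l = h ∧ l ≫ q = b := by
  obtain ⟨l, h1, h2, h3⟩ := hq.exists_lift_homotopy k (ι := Unit) (fun _ => i) u (fun _ => h) b
    (fun _ _ m x y hxy t => by rw [injective_of_mono i hxy]) (fun _ => hu) hub (fun _ => hb)
  exact ⟨l, h1, h2 (), h3⟩

theorem KanFibration.exists_lift_homotopy_abs (hq : KanFibration q) (k : Fin 2)
    {N : SSet.{0}} (u : N ⟶ E) (b : N ⊗ Δ[1] ⟶ B) (hub : ept N k ≫ b = u ≫ q) :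
    ∃ l : N ⊗ Δ[1] ⟶ E, ept N k ≫ l = u ∧ l ≫ q = b := by
  obtain ⟨l, h1, _, h3⟩ := hq.exists_lift_homotopy k (ι := Empty) (M := fun _ => N)
    (fun a => a.elim) u (fun a => a.elim) b
    (fun a => a.elim) (fun a => a.elim) hub (fun a => a.elim)
  exact ⟨l, h1, h3⟩

/-- Lifting a homotopy of homotopies with prescribed sides, rel a subobject. -/
theorem KanFibration.exists_lift_square (hq : KanFibration q) (k : Fin 2)
    {M P : SSet.{0}} (i : M ⟶ P) [Mono i] (u : P ⊗ Δ[1] ⟶ E) (h₀ h₁ : P ⊗ Δ[1] ⟶ E)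
    (h : (M ⊗ Δ[1]) ⊗ Δ[1] ⟶ E) (b : (P ⊗ Δ[1]) ⊗ Δ[1] ⟶ B)
    (h0u : ept P k ≫ h₀ = ept P 0 ≫ u) (h1u : ept P k ≫ h₁ = ept P 1 ≫ u)
    (hu : ept _ k ≫ h = i ▷ Δ[1] ≫ u)
    (h0 : i ▷ Δ[1] ≫ h₀ = ept M 0 ▷ Δ[1] ≫ h) (h1 : i ▷ Δ[1] ≫ h₁ = ept M 1 ▷ Δ[1] ≫ h)
    (hub : ept _ k ≫ b = u ≫ q)
    (h0b : h₀ ≫ q = ept P 0 ▷ Δ[1] ≫ b) (h1b : h₁ ≫ q = ept P 1 ▷ Δ[1] ≫ b)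
    (hb : h ≫ q = i ▷ Δ[1] ▷ Δ[1] ≫ b) :
    ∃ l : (P ⊗ Δ[1]) ⊗ Δ[1] ⟶ E, ept _ k ≫ l = u ∧ ept P 0 ▷ Δ[1] ≫ l = h₀ ∧
      ept P 1 ▷ Δ[1] ≫ l = h₁ ∧ i ▷ Δ[1] ▷ Δ[1] ≫ l = h ∧ l ≫ q = b := by
  let M' : Fin 3 → SSet.{0} := ![P, P, M ⊗ Δ[1]]
  let i' : ∀ o, M' o ⟶ P ⊗ Δ[1] := fun o => match o with
    | 0 => ept P 0
    | 1 => ept P 1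
    | 2 => i ▷ Δ[1]
  let h' : ∀ o, M' o ⊗ Δ[1] ⟶ E := fun o => match o with
    | 0 => h₀
    | 1 => h₁
    | 2 => h
  have k0 : ∀ m (x : P.obj m) (y : (M ⊗ Δ[1]).obj m), (ept P 0).app m x = (i ▷ Δ[1]).app m y →
      ∀ t, h₀.app m (pair x t) = h.app m (pair y t) := by
    intro m x y hxy t
    obtain ⟨y, s, rfl⟩ := exists_pair y
    rw [ept_app, whiskerRight_pair] at hxy
    obtain ⟨rfl, rfl⟩ := pair_inj.1 hxy
    exact app_congr h0 (pair y t)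
  have k1 : ∀ m (x : P.obj m) (y : (M ⊗ Δ[1]).obj m), (ept P 1).app m x = (i ▷ Δ[1]).app m y →
      ∀ t, h₁.app m (pair x t) = h.app m (pair y t) := by
    intro m x y hxy t
    obtain ⟨y, s, rfl⟩ := exists_pair y
    rw [ept_app, whiskerRight_pair] at hxy
    obtain ⟨rfl, rfl⟩ := pair_inj.1 hxy
    exact app_congr h1 (pair y t)
  obtain ⟨l, l1, l2, l3⟩ := hq.exists_lift_homotopy k i' u h' b (by
    intro a c m x y hxy t
    fin_cases a <;> fin_cases c
    · rw [injective_of_mono (ept P 0) hxy]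
    · exact absurd (congrArg Prod.snd hxy) (const_zero_ne_one m)
    · exact k0 m x y hxy t
    · exact absurd (congrArg Prod.snd hxy).symm (const_zero_ne_one m)
    · rw [injective_of_mono (ept P 1) hxy]
    · exact k1 m x y hxy t
    · exact (k0 m y x hxy.symm t).symm
    · exact (k1 m y x hxy.symm t).symm
    · rw [injective_of_mono (i ▷ Δ[1]) hxy]) (by
    intro a
    fin_cases a
    exacts [h0u, h1u, hu]) hub (by
    intro a
    fin_cases a
    exacts [h0b, h1b, hb])
  exact ⟨l, l1, l2 0, l2 1, l2 2, l3⟩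

end Lift

section Homotopies

theorem Homotopy.refl {X Y : SSet.{0}} (f : X ⟶ Y) : Homotopy f f :=
  ⟨CartesianMonoidalCategory.fst X Δ[1] ≫ f, rfl, rfl⟩

theorem Homotopy.comp_left {W X Y : SSet.{0}} {f g : X ⟶ Y} (h : Homotopy f g) (a : W ⟶ X) :
    Homotopy (a ≫ f) (a ≫ g) := by
  obtain ⟨H, rfl, rfl⟩ := h
  exact ⟨a ▷ Δ[1] ≫ H, rfl, rfl⟩

theorem Homotopy.comp_right {X Y Z : SSet.{0}} {f g : X ⟶ Y} (h : Homotopy f g) (a : Y ⟶ Z) :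
    Homotopy (f ≫ a) (g ≫ a) := by
  obtain ⟨H, rfl, rfl⟩ := h
  exact ⟨H ≫ a, rfl, rfl⟩

theorem eqvGen_map {α β : Type*} {r : α → α → Prop} {s : β → β → Prop} (φ : α → β)
    (h : ∀ x y, r x y → s (φ x) (φ y)) {x y : α} (hxy : Relation.EqvGen r x y) :
    Relation.EqvGen s (φ x) (φ y) := by
  induction hxy with
  | rel x y hxy => exact .rel _ _ (h x y hxy)
  | refl x => exact .refl _
  | symm x y _ ih => exact .symm _ _ ih
  | trans x y z _ _ ih ih' => exact .trans _ _ _ ih ih'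

theorem Homotopic.comp_left {W X Y : SSet.{0}} {f g : X ⟶ Y} (h : Homotopic f g) (a : W ⟶ X) :
    Homotopic (a ≫ f) (a ≫ g) :=
  eqvGen_map (fun f => a ≫ f) (fun _ _ h => Homotopy.comp_left h a) h

theorem Homotopic.comp_right {X Y Z : SSet.{0}} {f g : X ⟶ Y} (h : Homotopic f g) (a : Y ⟶ Z) :
    Homotopic (f ≫ a) (g ≫ a) :=
  eqvGen_map (fun f => f ≫ a) (fun _ _ h => Homotopy.comp_right h a) h

/-- Transport of a homotopy `u` along homotopies of its two ends, relative to a subobject. -/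
theorem KanFibration.exists_transport {E B : SSet.{0}} {q : E ⟶ B} (hq : KanFibration q)
    (k k' : Fin 2) {M P : SSet.{0}} (i : M ⟶ P) [Mono i] (u : P ⊗ Δ[1] ⟶ E)
    (h₀ h₁ : P ⊗ Δ[1] ⟶ E) (h : (M ⊗ Δ[1]) ⊗ Δ[1] ⟶ E) (b : (P ⊗ Δ[1]) ⊗ Δ[1] ⟶ B)
    (h0u : ept P k ≫ h₀ = ept P 0 ≫ u) (h1u : ept P k ≫ h₁ = ept P 1 ≫ u)
    (hu : ept _ k ≫ h = i ▷ Δ[1] ≫ u)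
    (h0 : i ▷ Δ[1] ≫ h₀ = ept M 0 ▷ Δ[1] ≫ h) (h1 : i ▷ Δ[1] ≫ h₁ = ept M 1 ▷ Δ[1] ≫ h)
    (hub : ept _ k ≫ b = u ≫ q)
    (h0b : h₀ ≫ q = ept P 0 ▷ Δ[1] ≫ b) (h1b : h₁ ≫ q = ept P 1 ▷ Δ[1] ≫ b)
    (hb : h ≫ q = i ▷ Δ[1] ▷ Δ[1] ≫ b) :
    ∃ w : P ⊗ Δ[1] ⟶ E, ept P 0 ≫ w = ept P k' ≫ h₀ ∧ ept P 1 ≫ w = ept P k' ≫ h₁ ∧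
      i ▷ Δ[1] ≫ w = ept _ k' ≫ h ∧ w ≫ q = ept _ k' ≫ b := by
  obtain ⟨l, -, l0, l1, lh, lq⟩ :=
    hq.exists_lift_square k i u h₀ h₁ h b h0u h1u hu h0 h1 hub h0b h1b hb
  refine ⟨ept _ k' ≫ l, ?_, ?_, ?_, ?_⟩
  · rw [← l0, ept_whiskerRight_assoc]
  · rw [← l1, ept_whiskerRight_assoc]
  · rw [← lh, ept_whiskerRight_assoc]
  · rw [← lq, Category.assoc]

theorem from_bot_tensor_ext {P E : SSet.{0}}
    (f g : ((⊥ : P.Subcomplex).toSSet ⊗ Δ[1]) ⟶ E) : f = g :=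
  hom_ext_app fun _ z => z.1.2.elim

theorem KanFibration.exists_transport_abs {E B : SSet.{0}} {q : E ⟶ B} (hq : KanFibration q)
    (k k' : Fin 2) {P : SSet.{0}} (u : P ⊗ Δ[1] ⟶ E)
    (h₀ h₁ : P ⊗ Δ[1] ⟶ E) (b : (P ⊗ Δ[1]) ⊗ Δ[1] ⟶ B)
    (h0u : ept P k ≫ h₀ = ept P 0 ≫ u) (h1u : ept P k ≫ h₁ = ept P 1 ≫ u)
    (hub : ept _ k ≫ b = u ≫ q)
    (h0b : h₀ ≫ q = ept P 0 ▷ Δ[1] ≫ b) (h1b : h₁ ≫ q = ept P 1 ▷ Δ[1] ≫ b) :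
    ∃ w : P ⊗ Δ[1] ⟶ E, ept P 0 ≫ w = ept P k' ≫ h₀ ∧ ept P 1 ≫ w = ept P k' ≫ h₁ ∧
      w ≫ q = ept _ k' ≫ b := by
  obtain ⟨w, w0, w1, -, w2⟩ := hq.exists_transport k k' (⊥ : P.Subcomplex).ι u h₀ h₁
    (homMk (fun _ z => z.1.1.2.elim) (fun _ z => z.1.1.2.elim)) b h0u h1u
    (from_bot_tensor_ext _ _) (from_bot_tensor_ext _ _) (from_bot_tensor_ext _ _) hub h0b h1b
    (hom_ext_app fun _ z => z.1.1.2.elim)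
  exact ⟨w, w0, w1, w2⟩

theorem KanComplex.exists_transport {K P : SSet.{0}} (hK : KanComplex K) (k k' : Fin 2)
    (u h₀ h₁ : P ⊗ Δ[1] ⟶ K)
    (h0u : ept P k ≫ h₀ = ept P 0 ≫ u) (h1u : ept P k ≫ h₁ = ept P 1 ≫ u) :
    Homotopy (ept P k' ≫ h₀) (ept P k' ≫ h₁) := by
  obtain ⟨w, w0, w1, -⟩ := KanFibration.exists_transport_abs hK k k' u h₀ h₁ (toPt _) h0u h1u
    (toPt_unique _ _) (toPt_unique _ _) (toPt_unique _ _)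
  exact ⟨w, w0, w1⟩

theorem Homotopy.symm {K P : SSet.{0}} (hK : KanComplex K) {f g : P ⟶ K} (h : Homotopy f g) :
    Homotopy g f := by
  obtain ⟨H, rfl, rfl⟩ := h
  have := hK.exists_transport 0 1 (CartesianMonoidalCategory.fst P Δ[1] ≫ ept P 0 ≫ H) H
    (CartesianMonoidalCategory.fst P Δ[1] ≫ ept P 0 ≫ H) (ept_fst_assoc 0 _).symm
    ((ept_fst_assoc 0 _).trans (ept_fst_assoc 1 _).symm)
  rwa [ept_fst_assoc] at this

theorem Homotopy.trans {K P : SSet.{0}} (hK : KanComplex K) {f g l : P ⟶ K} (h : Homotopy f g)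
    (h' : Homotopy g l) : Homotopy f l := by
  obtain ⟨H, rfl, hg⟩ := h
  obtain ⟨H', rfl, rfl⟩ := h'
  have := hK.exists_transport 0 1 H (CartesianMonoidalCategory.fst P Δ[1] ≫ ept P 0 ≫ H) H'
    (ept_fst_assoc 0 _) hg.symm
  rwa [ept_fst_assoc] at this

theorem Homotopic.homotopy {K P : SSet.{0}} (hK : KanComplex K) {f g : P ⟶ K}
    (h : Homotopic f g) : Homotopy f g := by
  induction h with
  | rel x y h => exact h
  | refl x => exact .refl x
  | symm x y _ ih => exact ih.symm hK
  | trans x y z _ _ ih ih' => exact ih.trans hK ih'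

/-- A Kan fibration between Kan complexes which is a homotopy equivalence is
a fiberwise deformation retraction. -/
theorem HomotopyEquivalence.exists_section {P Q : SSet.{0}} {f : P ⟶ Q}
    (hf : HomotopyEquivalence f) (hfib : KanFibration f) (hP : KanComplex P)
    (hQ : KanComplex Q) :
    ∃ (g : Q ⟶ P) (H : P ⊗ Δ[1] ⟶ P), g ≫ f = 𝟙 Q ∧ ept P 0 ≫ H = 𝟙 P ∧
      ept P 1 ≫ H = f ≫ g ∧ H ≫ f = CartesianMonoidalCategory.fst P Δ[1] ≫ f := by
  obtain ⟨g₀, h1, h2⟩ := hf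
  obtain ⟨A, A0, A1⟩ := h2.homotopy hQ
  obtain ⟨l, l0, l1⟩ := hfib.exists_lift_homotopy_abs 0 g₀ A A0
  have hg : (ept Q 1 ≫ l) ≫ f = 𝟙 Q := by rw [Category.assoc, l1, A1]
  have hl : Homotopy g₀ (ept Q 1 ≫ l) := ⟨l, l0, rfl⟩
  generalize ept Q 1 ≫ l = g at hg hl
  obtain ⟨H₀, e0, e1⟩ : Homotopy (𝟙 P) (f ≫ g) :=
    ((h1.homotopy hP).symm hP).trans hP (hl.comp_left f)
  obtain ⟨w, w0, w1, w2⟩ := hfib.exists_transport_abs 1 0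
    (CartesianMonoidalCategory.fst P Δ[1] ≫ f ≫ g) H₀ (H₀ ≫ f ≫ g)
    (CartesianMonoidalCategory.fst P Δ[1] ▷ Δ[1] ≫ H₀ ≫ f) e1
    (by rw [reassoc_of% e1, reassoc_of% hg]; rfl)
    (by
      rw [ept_whiskerRight_assoc, reassoc_of% e1]
      simp [hg]) rfl
    (by simp only [Category.assoc, hg, Category.comp_id]; rfl)
  refine ⟨g, w, hg, w0.trans e0, w1.trans (by rw [reassoc_of% e0]), w2.trans ?_⟩
  rw [ept_whiskerRight_assoc, reassoc_of% e0]

end Homotopies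

section Extension

theorem WeakHomotopyEquivalence.exists_extension {M N : SSet.{0}} {j : M ⟶ N} [Mono j]
    (hj : WeakHomotopyEquivalence j) {K : SSet.{0}} (hK : KanComplex K) :
    ∃ c : (M ⟶ K) → (N ⟶ K), (∀ e, j ≫ c e = e) ∧
      ∀ α : N ⟶ K, ∃ γ : N ⊗ Δ[1] ⟶ K, ept N 0 ≫ γ = α ∧ ept N 1 ≫ γ = c (j ≫ α) ∧
        j ▷ Δ[1] ≫ γ = CartesianMonoidalCategory.fst M Δ[1] ≫ j ≫ α := by
  obtain ⟨g, H, hg, H0, H1, Hr⟩ := (hj K hK).exists_section (kanFibration_pre j hK)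
    (kanComplex_ihom N hK) (kanComplex_ihom M hK)
  refine ⟨fun e => (ρ_ N).inv ≫ MonoidalClosed.uncurry
    (MonoidalClosed.curry ((ρ_ M).hom ≫ e) ≫ g), fun e => ?_, fun α => ?_⟩
  · have h : j ▷ _ ≫ MonoidalClosed.uncurry (MonoidalClosed.curry ((ρ_ M).hom ≫ e) ≫ g) =
        (ρ_ M).hom ≫ e := by
      apply MonoidalClosed.curry_injective
      rw [← MonoidalClosed.curry_pre_app, MonoidalClosed.curry_uncurry, Category.assoc, hg,
        Category.comp_id]
    calc _ = (ρ_ M).inv ≫ j ▷ _ ≫ MonoidalClosed.uncurry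
          (MonoidalClosed.curry ((ρ_ M).hom ≫ e) ≫ g) := rfl
      _ = e := by rw [h, Iso.inv_hom_id_assoc]
  · refine ⟨N ◁ (λ_ Δ[1]).inv ≫ MonoidalClosed.uncurry
      (MonoidalClosed.curry ((ρ_ N).hom ≫ α) ▷ Δ[1] ≫ H), ?_, ?_, ?_⟩
    · calc _ = (ρ_ N).inv ≫ N ◁ ept (𝟙_ SSet.{0}) 0 ≫ MonoidalClosed.uncurry
            (MonoidalClosed.curry ((ρ_ N).hom ≫ α) ▷ Δ[1] ≫ H) := rfl
        _ = α := by
          rw [← MonoidalClosed.uncurry_natural_left, ept_whiskerRight_assoc, H0, Category.comp_id,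
            MonoidalClosed.uncurry_curry, Iso.inv_hom_id_assoc]
    · calc _ = (ρ_ N).inv ≫ N ◁ ept (𝟙_ SSet.{0}) 1 ≫ MonoidalClosed.uncurry
            (MonoidalClosed.curry ((ρ_ N).hom ≫ α) ▷ Δ[1] ≫ H) := rfl
        _ = _ := by
          rw [← MonoidalClosed.uncurry_natural_left, ept_whiskerRight_assoc, H1,
            ← Category.assoc (MonoidalClosed.curry _), MonoidalClosed.curry_pre_app]
          rfl
    · calc _ = M ◁ (λ_ Δ[1]).inv ≫ j ▷ _ ≫ MonoidalClosed.uncurry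
            (MonoidalClosed.curry ((ρ_ N).hom ≫ α) ▷ Δ[1] ≫ H) := rfl
        _ = M ◁ (λ_ Δ[1]).inv ≫ M ◁ CartesianMonoidalCategory.fst (𝟙_ SSet.{0}) Δ[1] ≫ j ▷ _ ≫
              (ρ_ N).hom ≫ α := by
          congr 1
          apply MonoidalClosed.curry_injective
          rw [← MonoidalClosed.curry_pre_app, MonoidalClosed.curry_uncurry, Category.assoc, Hr,
            MonoidalClosed.curry_natural_left, ← MonoidalClosed.curry_pre_app]
          rfl
        _ = _ := rfl

theorem WeakHomotopyEquivalence.hasLiftingProperty {M N : SSet.{0}} {j : M ⟶ N} [Mono j]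
    (hj : WeakHomotopyEquivalence j) {E B : SSet.{0}} {q : E ⟶ B} (hq : KanFibration q)
    (hB : KanComplex B) : HasLiftingProperty j q := by
  refine ⟨fun {a b} sq => ?_⟩
  obtain ⟨cE, hcE, -⟩ := hj.exists_extension (hq.kanComplex hB)
  obtain ⟨cB, -, hcB⟩ := hj.exists_extension hB
  obtain ⟨γ₁, s1, t1, r1⟩ := hcB (cE a ≫ q)
  obtain ⟨γ₂, s2, t2, r2⟩ := hcB b
  have hab : j ≫ cE a ≫ q = j ≫ b := by rw [reassoc_of% (hcE a), sq.w]
  obtain ⟨l₁, u1, v1, w1⟩ := hq.exists_lift_homotopy_mono 0 j (cE a)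
    (CartesianMonoidalCategory.fst M Δ[1] ≫ a) γ₁ (by rw [hcE]; rfl) s1
    (by rw [r1, reassoc_of% (hcE a), Category.assoc])
  obtain ⟨l₂, u2, v2, w2⟩ := hq.exists_lift_homotopy_mono 1 j (ept N 1 ≫ l₁)
    (CartesianMonoidalCategory.fst M Δ[1] ≫ a) γ₂
    (by rw [← ept_whiskerRight_assoc, v1]) (by rw [Category.assoc, w1, t1, t2, hab])
    (by rw [r2, Category.assoc, sq.w])
  refine ⟨⟨⟨ept N 0 ≫ l₂, ?_, ?_⟩⟩⟩
  · rw [← ept_whiskerRight_assoc, v2, ept_fst_assoc]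
  · rw [Category.assoc, w2, s2]

end Extension

section Cofree

/-- The cofree simplicial set on a set `S`: maps into it are families of functions to `S`
defined on the sets of simplices of each dimension. -/
def cofree (S : Type) : SSet.{0} where
  obj m := ∀ l : SimplexCategoryᵒᵖ, (m ⟶ l) → S
  map φ := ↾fun c l f => c l (φ ≫ f)
  map_id m := ConcreteCategory.hom_ext _ _ fun c => by
    funext l f
    change c l (𝟙 m ≫ f) = c l f
    rw [Category.id_comp]
  map_comp φ ψ := ConcreteCategory.hom_ext _ _ fun c => by
    funext l f
    change c l ((φ ≫ ψ) ≫ f) = c l (φ ≫ ψ ≫ f)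
    rw [Category.assoc]

theorem cofree_map {S : Type} {m l k : SimplexCategoryᵒᵖ} (φ : m ⟶ l) (c : (cofree S).obj m)
    (f : l ⟶ k) : (cofree S).map φ c k f = c k (φ ≫ f) := rfl

/-- The map to a cofree simplicial set corresponding to a family of functions. -/
def toCofree {X : SSet.{0}} {S : Type} (φ : ∀ m, X.obj m → S) : X ⟶ cofree S :=
  homMk (fun _ x l f => φ l (X.map f x)) fun g x => by
    funext l f
    exact congrArg (φ l) (map_comp_apply X g f x).symm

theorem toCofree_app {X : SSet.{0}} {S : Type} (φ : ∀ m, X.obj m → S) {m l : SimplexCategoryᵒᵖ}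
    (x : X.obj m) (f : m ⟶ l) : (toCofree φ).app m x l f = φ l (X.map f x) := rfl

theorem toCofree_app_id {X : SSet.{0}} {S : Type} (φ : ∀ m, X.obj m → S) {m : SimplexCategoryᵒᵖ}
    (x : X.obj m) : (toCofree φ).app m x m (𝟙 m) = φ m x := by
  rw [toCofree_app, map_id_apply]

theorem cofree_hom_app {X : SSet.{0}} {S : Type} (g : X ⟶ cofree S) {m l : SimplexCategoryᵒᵖ}
    (x : X.obj m) (f : m ⟶ l) : g.app m x l f = g.app l (X.map f x) l (𝟙 l) := by
  rw [app_map, cofree_map, Category.comp_id]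

theorem cofree_hom_ext {X : SSet.{0}} {S : Type} {g h : X ⟶ cofree S}
    (H : ∀ m x, g.app m x m (𝟙 m) = h.app m x m (𝟙 m)) : g = h :=
  hom_ext_app fun m x => by
    funext l f
    rw [cofree_hom_app, cofree_hom_app h, H]

theorem exists_cofree_extension {A B : SSet.{0}} {S : Type} [Nonempty S] (i : A ⟶ B) [Mono i]
    (g : A ⟶ cofree S) : ∃ g' : B ⟶ cofree S, i ≫ g' = g := by
  classical
  refine ⟨toCofree fun m b => if h : ∃ a, i.app m a = b then g.app m h.choose m (𝟙 m)
    else Classical.arbitrary S, cofree_hom_ext fun m a => ?_⟩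
  have h : ∃ a', i.app m a' = i.app m a := ⟨a, rfl⟩
  rw [comp_app_apply, toCofree_app_id, dif_pos h, injective_of_mono i h.choose_spec]

theorem trivialFibration_fst_cofree (Y : SSet.{0}) (S : Type) [Nonempty S] :
    TrivialFibration (CartesianMonoidalCategory.fst Y (cofree S)) := fun n =>
  ⟨fun {g b} sq => by
    obtain ⟨g', hg'⟩ := exists_cofree_extension (SSet.boundary n).ι
      (g ≫ CartesianMonoidalCategory.snd _ _)
    refine ⟨⟨⟨CartesianMonoidalCategory.lift b g', ?_, by simp⟩⟩⟩
    ext1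
    · simp [sq.w]
    · simp [hg']⟩

theorem mono_lift_toCofree {X Y : SSet.{0}} (p : X ⟶ Y) {S : Type} (φ : ∀ m, X.obj m → S)
    (h : ∀ m x x', p.app m x = p.app m x' → φ m x = φ m x' → x = x') :
    Mono (CartesianMonoidalCategory.lift p (toCofree φ)) :=
  mono_of_injective fun m x x' hx => by
    refine h m x x' (congrArg Prod.fst hx) ?_
    have := congrArg (fun z => z.2 m (𝟙 m)) hx
    rw [← toCofree_app_id φ x, ← toCofree_app_id φ x']
    exact this

theorem exists_factorization {X Y : SSet.{0}} (p : X ⟶ Y) :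
    ∃ (Z : SSet.{0}) (j : X ⟶ Z) (q : Z ⟶ Y), Mono j ∧ TrivialFibration q ∧ j ≫ q = p :=
  ⟨Y ⊗ cofree (Option (Σ m, X.obj m)),
    CartesianMonoidalCategory.lift p (toCofree fun m x => some ⟨m, x⟩),
    CartesianMonoidalCategory.fst _ _,
    mono_lift_toCofree p _ fun m x x' _ h => by simpa using h,
    trivialFibration_fst_cofree _ _, by simp⟩

end Cofree

section Universe

variable {C : SSet.{0}}

/-- A subcomplex of `Y ⊗ C` whose projection to `Y` is a Kan fibration. -/
def KanSub {Y : SSet.{0}} (B : (Y ⊗ C).Subcomplex) : Prop :=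
  KanFibration (B.ι ≫ CartesianMonoidalCategory.fst Y C)

theorem kanSub_iff {Y : SSet.{0}} (B : (Y ⊗ C).Subcomplex) :
    KanSub B ↔ ∀ (n : ℕ) (i : Fin (n + 2)) (b : Δ[n + 1] ⟶ Y)
      (c : (horn (n + 1) i : SSet.{0}) ⟶ C),
      (∀ m x, pair (b.app m x.1) (c.app m x) ∈ B.obj m) →
      ∃ c' : Δ[n + 1] ⟶ C, (horn (n + 1) i).ι ≫ c' = c ∧
        ∀ m x, pair (b.app m x) (c'.app m x) ∈ B.obj m := by
  constructor
  · intro hB n i b c hc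
    have := hB n i
    have sq : CommSq (Subcomplex.lift (B := B) (CartesianMonoidalCategory.lift
        ((horn (n + 1) i).ι ≫ b) c) (by rintro m _ ⟨x, rfl⟩; exact hc m x))
        (horn (n + 1) i).ι (B.ι ≫ CartesianMonoidalCategory.fst Y C) b := ⟨rfl⟩
    refine ⟨sq.lift ≫ B.ι ≫ CartesianMonoidalCategory.snd Y C, ?_, fun m x => ?_⟩
    · rw [sq.fac_left_assoc]
      rfl
    · have h := app_congr sq.fac_right x
      rw [← h]
      exact (sq.lift.app m x).2
  · refine fun hB n i => ⟨fun {g b} sq => ?_⟩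
    obtain ⟨c', h1, h2⟩ := hB n i b (g ≫ B.ι ≫ CartesianMonoidalCategory.snd Y C) (by
      intro m x
      have h : (g.app m x).1.1 = b.app m x.1 := app_congr sq.w x
      rw [← h]
      exact (g.app m x).2)
    refine ⟨⟨⟨Subcomplex.lift (CartesianMonoidalCategory.lift b c')
      (by rintro m _ ⟨x, rfl⟩; exact h2 m x), ?_, rfl⟩⟩⟩
    refine hom_ext_app fun m x => Subtype.ext (Prod.ext ?_ ?_)
    · exact (app_congr sq.w x).symm
    · exact app_congr h1 x

theorem KanSub.preimage {Y Y' : SSet.{0}} {B : (Y ⊗ C).Subcomplex} (hB : KanSub B)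
    (f : Y' ⟶ Y) : KanSub (B.preimage (f ▷ C)) := by
  rw [kanSub_iff] at hB ⊢
  exact fun n i b c hc => hB n i (b ≫ f) c hc

/-- The simplex of the standard simplex corresponding to the identity. -/
def idS (m : SimplexCategoryᵒᵖ) : (stdSimplex.{0}.obj m.unop).obj m :=
  stdSimplex.objEquiv.symm (𝟙 m.unop)

/-- The map from the standard simplex representing a simplex. -/
def ofS {Y : SSet.{0}} {m : SimplexCategoryᵒᵖ} (y : Y.obj m) : stdSimplex.{0}.obj m.unop ⟶ Y :=
  yonedaEquiv.symm y

theorem exists_map_idS {m l : SimplexCategoryᵒᵖ} (x : (stdSimplex.{0}.obj m.unop).obj l) :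
    ∃ f : m ⟶ l, x = (stdSimplex.{0}.obj m.unop).map f (idS m) :=
  ⟨(stdSimplex.objEquiv x).op, by
    apply stdSimplex.objEquiv.injective
    exact (Category.comp_id _).symm⟩

theorem ofS_idS {Y : SSet.{0}} {m : SimplexCategoryᵒᵖ} (y : Y.obj m) :
    (ofS y).app m (idS m) = y :=
  map_id_apply Y y

theorem ofS_map_idS {Y : SSet.{0}} {m l : SimplexCategoryᵒᵖ} (y : Y.obj m) (f : m ⟶ l) :
    (ofS y).app l ((stdSimplex.{0}.obj m.unop).map f (idS m)) = Y.map f y := by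
  rw [app_map, ofS_idS]

theorem stdSimplex_map_idS {m l : SimplexCategoryᵒᵖ} (f : m ⟶ l) :
    (stdSimplex.{0}.map f.unop).app l (idS l) = (stdSimplex.{0}.obj m.unop).map f (idS m) := by
  apply stdSimplex.objEquiv.injective
  exact (Category.id_comp f.unop).trans (Category.comp_id f.unop).symm

theorem from_stdSimplex_ext {Y : SSet.{0}} {m : SimplexCategoryᵒᵖ}
    {f g : stdSimplex.{0}.obj m.unop ⟶ Y} (h : f.app m (idS m) = g.app m (idS m)) : f = g := by
  refine hom_ext_app fun l x => ?_
  obtain ⟨φ, rfl⟩ := exists_map_idS x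
  rw [app_map, app_map, h]

theorem stdSimplex_map_ofS {Y : SSet.{0}} {m l : SimplexCategoryᵒᵖ} (f : m ⟶ l) (y : Y.obj m) :
    stdSimplex.{0}.map f.unop ≫ ofS y = ofS (Y.map f y) := by
  apply from_stdSimplex_ext
  rw [comp_app_apply, stdSimplex_map_idS, ofS_map_idS, ofS_idS]

theorem preimage_eq_self {Y : SSet.{0}} {f : Y ⟶ Y} (h : f = 𝟙 Y) (A : (Y ⊗ C).Subcomplex) :
    A.preimage (f ▷ C) = A := by
  subst h
  rfl

theorem preimage_eq_preimage {Y Y' Y'' : SSet.{0}} {f : Y ⟶ Y'} {g : Y' ⟶ Y''} {h : Y ⟶ Y''}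
    (e : h = f ≫ g) (A : (Y'' ⊗ C).Subcomplex) :
    A.preimage (h ▷ C) = (A.preimage (g ▷ C)).preimage (f ▷ C) := by
  subst e
  rfl

variable (C) in
/-- The classifying object for Kan fibrations embedded in products with `C`. -/
def univ : SSet.{0} where
  obj m := { A : (stdSimplex.{0}.obj m.unop ⊗ C).Subcomplex // KanSub A }
  map f := ↾fun A => ⟨A.1.preimage (stdSimplex.{0}.map f.unop ▷ C), A.2.preimage _⟩
  map_id m := ConcreteCategory.hom_ext _ _ fun A =>
    Subtype.ext (preimage_eq_self (stdSimplex.map_id m.unop) A.1)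
  map_comp f g := ConcreteCategory.hom_ext _ _ fun A =>
    Subtype.ext (preimage_eq_preimage (stdSimplex.map_comp g.unop f.unop) A.1)

theorem mem_univ_map {m l : SimplexCategoryᵒᵖ} (f : m ⟶ l) (A : (univ C).obj m) (c : C.obj l) :
    pair (idS l) c ∈ ((univ C).map f A).1.obj l ↔
      pair ((stdSimplex.{0}.obj m.unop).map f (idS m)) c ∈ A.1.obj l := by
  rw [← stdSimplex_map_idS]
  rfl

/-- The subcomplex classified by a map to the universe. -/
def tot {Y : SSet.{0}} (χ : Y ⟶ univ C) : (Y ⊗ C).Subcomplex where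
  obj m := {z | pair (idS m) z.2 ∈ (χ.app m z.1).1.obj m}
  map := by
    rintro m l f ⟨y, c⟩ h
    change pair (idS l) (C.map f c) ∈ (χ.app l (Y.map f y)).1.obj l
    rw [app_map, mem_univ_map, ← pair_map]
    exact (χ.app m y).1.map f h

theorem mem_tot {Y : SSet.{0}} (χ : Y ⟶ univ C) {m : SimplexCategoryᵒᵖ} (y : Y.obj m)
    (c : C.obj m) : pair y c ∈ (tot χ).obj m ↔ pair (idS m) c ∈ (χ.app m y).1.obj m := Iff.rfl

theorem mem_tot_map {Y : SSet.{0}} (χ : Y ⟶ univ C) {m l : SimplexCategoryᵒᵖ} (f : m ⟶ l)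
    (y : Y.obj m) (c : C.obj l) : pair (Y.map f y) c ∈ (tot χ).obj l ↔
      pair ((stdSimplex.{0}.obj m.unop).map f (idS m)) c ∈ (χ.app m y).1.obj l := by
  rw [mem_tot, app_map, mem_univ_map]

theorem kanSub_tot {Y : SSet.{0}} (χ : Y ⟶ univ C) : KanSub (tot χ) := by
  rw [kanSub_iff]
  intro n i b c hc
  have key : ∀ m (x : (Δ[n + 1] : SSet.{0}).obj m) (c : C.obj m),
      pair (b.app m x) c ∈ (tot χ).obj m ↔
        pair x c ∈ (χ.app (.op ⦋n + 1⦌) (b.app _ (idS (.op ⦋n + 1⦌)))).1.obj m := by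
    intro m x c
    obtain ⟨f, rfl⟩ := exists_map_idS (m := .op ⦋n + 1⦌) x
    rw [app_map, mem_tot_map]
  obtain ⟨c', h1, h2⟩ := (kanSub_iff _).1 (χ.app (.op ⦋n + 1⦌) (b.app _ (idS (.op ⦋n + 1⦌)))).2
    n i (𝟙 _) c fun m x => (key m x.1 _).1 (hc m x)
  exact ⟨c', h1, fun m x => (key m x _).2 (h2 m x)⟩

/-- The classifying map of a Kan fibration embedded in a product with `C`. -/
def classify {Y : SSet.{0}} (B : (Y ⊗ C).Subcomplex) (hB : KanSub B) : Y ⟶ univ C :=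
  homMk (fun _ y => ⟨B.preimage (ofS y ▷ C), hB.preimage _⟩) fun f y => Subtype.ext (by
    exact congrArg (fun t => B.preimage (t ▷ C)) (stdSimplex_map_ofS f y).symm)

theorem tot_classify {Y : SSet.{0}} (B : (Y ⊗ C).Subcomplex) (hB : KanSub B) :
    tot (classify B hB) = B := by
  apply Subfunctor.ext
  funext m
  ext ⟨y, c⟩
  change pair ((ofS y).app m (idS m)) c ∈ B.obj m ↔ _
  rw [ofS_idS]
  rfl

theorem classify_tot {Y : SSet.{0}} (χ : Y ⟶ univ C) : classify (tot χ) (kanSub_tot χ) = χ := by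
  refine hom_ext_app fun m y => Subtype.ext ?_
  apply Subfunctor.ext
  funext l
  ext ⟨x, c⟩
  obtain ⟨f, rfl⟩ := exists_map_idS x
  change pair ((ofS y).app l ((stdSimplex.{0}.obj m.unop).map f (idS m))) c ∈ (tot χ).obj l ↔
    pair _ _ ∈ _
  rw [ofS_map_idS, mem_tot_map]

theorem tot_comp {Y Y' : SSet.{0}} (f : Y' ⟶ Y) (χ : Y ⟶ univ C) :
    tot (f ≫ χ) = (tot χ).preimage (f ▷ C) := rfl

theorem hom_univ_ext {Y : SSet.{0}} {χ χ' : Y ⟶ univ C} (h : tot χ = tot χ') : χ = χ' := by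
  rw [← classify_tot χ, ← classify_tot χ']
  congr 1

end Universe

section Deformation

open CartesianMonoidalCategory (fst)

/-- Lifting against the fibration extended along a strong deformation retract `Z ⟶ W`. -/
theorem KanFibration.exists_lift_deformation {A Z W H K M N : SSet.{0}} {p : A ⟶ Z}
    (hp : KanFibration p) (k k' : Fin 2) (z : Z ⟶ W) (r : Z ⊗ Δ[1] ⟶ Z) (r₁ : W ⟶ Z)
    (hr : ept Z k ≫ r = 𝟙 Z) (hr' : ept Z k' ≫ r = z ≫ r₁)
    (s : A ⊗ Δ[1] ⟶ A) (hs : ept A k ≫ s = 𝟙 A) (hsp : s ≫ p = p ▷ Δ[1] ≫ r)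
    (i : H ⟶ K) [Mono i] [HasLiftingProperty i p] (j : M ⟶ K) [Mono j] (u : N ⟶ M) [Mono u]
    (v : N ⟶ H) (huv : u ≫ j = v ≫ i)
    (hpb : ∀ m (x : M.obj m) (y : H.obj m), j.app m x = i.app m y →
      ∃ n, u.app m n = x ∧ v.app m n = y)
    (w : K ⟶ W) (wZ : M ⟶ Z) (hw : wZ ≫ z = j ≫ w)
    (e : H ⟶ A) (he : e ≫ p = i ≫ w ≫ r₁) (a : N ⟶ A) (ha : a ≫ p = u ≫ wZ)
    (hae : a ≫ ept A k' ≫ s = v ≫ e) :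
    ∃ (a' : M ⟶ A) (e' : K ⟶ A), a' ≫ p = wZ ∧ u ≫ a' = a ∧ e' ≫ p = w ≫ r₁ ∧ i ≫ e' = e ∧
      j ≫ e' = a' ≫ ept A k' ≫ s := by
  have sq : CommSq e i p (w ≫ r₁) := ⟨he⟩
  let e₀ : K ⟶ A := sq.lift
  have he₀ : i ≫ e₀ = e := sq.fac_left
  have he₀p : e₀ ≫ p = w ≫ r₁ := sq.fac_right
  clear_value e₀
  have hasp : (a ▷ Δ[1] ≫ s) ≫ p = u ▷ Δ[1] ≫ wZ ▷ Δ[1] ≫ r := by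
    rw [Category.assoc, hsp, ← comp_whiskerRight_assoc, ha, comp_whiskerRight_assoc]
  obtain ⟨γ, γ1, γ2, γ3⟩ := hp.exists_lift_homotopy_mono k' u (j ≫ e₀) (a ▷ Δ[1] ≫ s)
    (wZ ▷ Δ[1] ≫ r)
    (by rw [ept_whiskerRight_assoc, hae, ← he₀, ← Category.assoc, ← huv, Category.assoc])
    (by rw [ept_whiskerRight_assoc, hr', Category.assoc, he₀p, ← Category.assoc, hw,
      Category.assoc])
    hasp
  have hγ : (ept M k ≫ γ) ≫ p = wZ := by
    rw [Category.assoc, γ3, ept_whiskerRight_assoc, hr, Category.comp_id]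
  have huγ : u ≫ ept M k ≫ γ = a := by
    rw [← ept_whiskerRight_assoc, γ2, ept_whiskerRight_assoc, hs, Category.comp_id]
  generalize ha' : ept M k ≫ γ = a' at hγ huγ
  obtain ⟨θ, θ0, θ1, θ2, θ3⟩ := hp.exists_transport k k' u (fst M Δ[1] ≫ a') γ (a' ▷ Δ[1] ≫ s)
    (fst N Δ[1] ▷ Δ[1] ≫ a ▷ Δ[1] ≫ s) (fst M Δ[1] ▷ Δ[1] ≫ wZ ▷ Δ[1] ≫ r)
    (by rw [ha', ept_fst_assoc])
    (by rw [ept_whiskerRight_assoc, hs, Category.comp_id, ept_fst_assoc])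
    (by rw [ept_whiskerRight_assoc, ept_whiskerRight_assoc, hs, Category.comp_id, ← huγ]; rfl)
    (by rw [γ2, ← comp_whiskerRight_assoc, ept_fst, id_whiskerRight, Category.id_comp])
    (by rw [← comp_whiskerRight_assoc, huγ, ← comp_whiskerRight_assoc, ept_fst, id_whiskerRight,
      Category.id_comp])
    (by rw [ept_whiskerRight_assoc, ept_whiskerRight_assoc, hr, Category.comp_id, Category.assoc,
      hγ])
    (by rw [γ3, ← comp_whiskerRight_assoc, ept_fst, id_whiskerRight, Category.id_comp])
    (by rw [Category.assoc, hsp, ← comp_whiskerRight_assoc, hγ, ← comp_whiskerRight_assoc, ept_fst,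
      id_whiskerRight, Category.id_comp])
    (by rw [Category.assoc, hasp, ← comp_whiskerRight_assoc, ← comp_whiskerRight_assoc]; rfl)
  let M' : Bool → SSet.{0} := fun o => bif o then H else M
  let i' : ∀ o, M' o ⟶ K := fun o => match o with
    | true => i
    | false => j
  let h' : ∀ o, M' o ⊗ Δ[1] ⟶ A := fun o => match o with
    | true => fst H Δ[1] ≫ e
    | false => θ
  have key : ∀ m (x : M.obj m) (y : H.obj m), j.app m x = i.app m y → ∀ t,
      θ.app m (pair x t) = (fst H Δ[1] ≫ e).app m (pair y t) := by
    intro m x y hxy t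
    obtain ⟨n, rfl, rfl⟩ := hpb m x y hxy
    refine (app_congr θ2 (pair n t)).trans ?_
    rw [ept_whiskerRight_assoc, ept_whiskerRight_assoc, hae]
    rfl
  obtain ⟨l, l1, l2, l3⟩ := hp.exists_lift_homotopy 0 i' e₀ h' (fst K Δ[1] ≫ w ≫ r₁) (by
    intro b c m x y hxy t
    cases b <;> cases c
    · rw [injective_of_mono j hxy]
    · exact key m x y hxy t
    · exact (key m y x hxy.symm t).symm
    · rw [injective_of_mono i hxy]) (by
    intro b
    cases b
    · exact θ0.trans γ1
    · exact (ept_fst_assoc 0 e).trans he₀.symm) (by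
    rw [ept_fst_assoc, he₀p]) (by
    intro b
    cases b
    · refine θ3.trans ?_
      rw [ept_whiskerRight_assoc, ept_whiskerRight_assoc, hr', ← Category.assoc wZ, hw]
      rfl
    · exact (Category.assoc _ _ _).trans (congrArg (fun t => fst H Δ[1] ≫ t) he))
  refine ⟨a', ept K 1 ≫ l, hγ, huγ, ?_, ?_, ?_⟩
  · rw [Category.assoc, l3, ept_fst_assoc]
  · rw [← ept_whiskerRight_assoc]
    exact (congrArg (fun t => ept H 1 ≫ t) (l2 true)).trans (ept_fst_assoc 1 e)
  · rw [← ept_whiskerRight_assoc]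
    refine (congrArg (fun t => ept M 1 ≫ t) (l2 false)).trans (θ1.trans ?_)
    rw [ept_whiskerRight_assoc]

end Deformation

section Glue

open CartesianMonoidalCategory (fst snd)

variable {W : SSet.{0}} {S : Type} {Z : W.Subcomplex} {A : (Z.toSSet ⊗ cofree S).Subcomplex}
  (r₁ : W ⟶ Z.toSSet) (s₁ : A.toSSet ⟶ A.toSSet)

/-- The relation expressing that `s₁` sends the simplex `c` of the fiber over `z` to `e`. -/
def FiberRel (s₁ : A.toSSet ⟶ A.toSSet) {m : SimplexCategoryᵒᵖ} (z : Z.toSSet.obj m)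
    (c e : (cofree S).obj m) : Prop :=
  ∃ h : pair z c ∈ A.obj m, (s₁.app m ⟨_, h⟩).1.2 = e

/-- The relation between a simplex `c` of the glued object over `w` and the
underlying simplex `e` of the fibration pulled back along `r₁`. -/
def GlueRel {m : SimplexCategoryᵒᵖ} (w : W.obj m) (c e : (cofree S).obj m) : Prop :=
  pair (r₁.app m w) e ∈ A.obj m ∧
    (∀ l (f : m ⟶ l) (z : Z.toSSet.obj l), z.1 = W.map f w →
      FiberRel s₁ z ((cofree S).map f c) ((cofree S).map f e)) ∧
    ∀ l (f : m ⟶ l), W.map f w ∉ Z.obj l → c l f = e l f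

variable {r₁ s₁}

theorem FiberRel.map {m l : SimplexCategoryᵒᵖ} (f : m ⟶ l) {z : Z.toSSet.obj m}
    {c e : (cofree S).obj m} (h : FiberRel s₁ z c e) :
    FiberRel s₁ (Z.toSSet.map f z) ((cofree S).map f c) ((cofree S).map f e) := by
  obtain ⟨h, rfl⟩ := h
  exact ⟨A.map f h, congrArg (fun t => t.1.2) (app_map s₁ f ⟨_, h⟩)⟩

theorem FiberRel.unique {m : SimplexCategoryᵒᵖ} {z : Z.toSSet.obj m}
    {c e e' : (cofree S).obj m} (h : FiberRel s₁ z c e) (h' : FiberRel s₁ z c e') : e = e' :=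
  h.2.symm.trans h'.2

theorem GlueRel.map {m l : SimplexCategoryᵒᵖ} (f : m ⟶ l) {w : W.obj m}
    {c e : (cofree S).obj m} (h : GlueRel r₁ s₁ w c e) :
    GlueRel r₁ s₁ (W.map f w) ((cofree S).map f c) ((cofree S).map f e) := by
  refine ⟨?_, fun k g z hz => ?_, fun k g hg => ?_⟩
  · rw [app_map, ← pair_map]
    exact A.map f h.1
  · rw [← map_comp_apply] at hz ⊢
    rw [← map_comp_apply]
    exact h.2.1 _ _ _ hz
  · rw [← map_comp_apply] at hg
    exact h.2.2 _ _ hg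

theorem GlueRel.fiberRel {m : SimplexCategoryᵒᵖ} {w : W.obj m} {c e : (cofree S).obj m}
    (h : GlueRel r₁ s₁ w c e) (z : Z.toSSet.obj m) (hz : z.1 = w) : FiberRel s₁ z c e := by
  have := h.2.1 m (𝟙 m) z (hz.trans (map_id_apply W w).symm)
  rwa [map_id_apply, map_id_apply] at this

theorem GlueRel.eq_of_notMem {m : SimplexCategoryᵒᵖ} {w : W.obj m} {c e : (cofree S).obj m}
    (h : GlueRel r₁ s₁ w c e) (hw : w ∉ Z.obj m) : c m (𝟙 m) = e m (𝟙 m) :=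
  h.2.2 m (𝟙 m) (by rwa [map_id_apply])

theorem GlueRel.unique {m : SimplexCategoryᵒᵖ} {w : W.obj m} {c e e' : (cofree S).obj m}
    (h : GlueRel r₁ s₁ w c e) (h' : GlueRel r₁ s₁ w c e') : e = e' := by
  funext l f
  by_cases hf : W.map f w ∈ Z.obj l
  · have := (h.2.1 l f ⟨_, hf⟩ rfl).unique (h'.2.1 l f ⟨_, hf⟩ rfl)
    have := congrFun (congrFun this l) (𝟙 l)
    rwa [cofree_map, cofree_map, Category.comp_id] at this
  · rw [← h.2.2 l f hf, h'.2.2 l f hf]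

theorem glueRel_of_hom {K : SSet.{0}} (w : K ⟶ W) (c e : K ⟶ cofree S)
    (h1 : ∀ m x, pair (r₁.app m (w.app m x)) (e.app m x) ∈ A.obj m)
    (h2 : ∀ m x (z : Z.toSSet.obj m), z.1 = w.app m x → FiberRel s₁ z (c.app m x) (e.app m x))
    (h3 : ∀ m x, w.app m x ∉ Z.obj m → c.app m x m (𝟙 m) = e.app m x m (𝟙 m))
    {m : SimplexCategoryᵒᵖ} (x : K.obj m) :
    GlueRel r₁ s₁ (w.app m x) (c.app m x) (e.app m x) := by
  refine ⟨h1 m x, fun l f z hz => ?_, fun l f hf => ?_⟩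
  · rw [← app_map] at hz
    rw [← app_map, ← app_map]
    exact h2 _ _ _ hz
  · rw [← app_map] at hf
    rw [cofree_hom_app, h3 _ _ hf, ← cofree_hom_app]

variable (r₁ s₁) in
/-- The glued subcomplex of `W ⊗ cofree S` extending `A`. -/
def glue : (W ⊗ cofree S).Subcomplex where
  obj m := {x | ∃ e, GlueRel r₁ s₁ x.1 x.2 e}
  map := by
    rintro m l f x ⟨e, he⟩
    exact ⟨_, he.map f⟩

theorem preimage_glue
    (hs : s₁ ≫ A.ι ≫ fst _ _ = (A.ι ≫ fst _ _) ≫ Z.ι ≫ r₁) :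
    (glue r₁ s₁).preimage (Z.ι ▷ cofree S) = A := by
  apply Subfunctor.ext
  funext m
  ext ⟨z, c⟩
  constructor
  · rintro ⟨e, he⟩
    exact (he.fiberRel z rfl).1
  · intro h
    have hR : FiberRel s₁ z c (s₁.app m ⟨_, h⟩).1.2 := ⟨h, rfl⟩
    refine ⟨(s₁.app m ⟨_, h⟩).1.2, ?_, fun l f z' hz' => ?_,
      fun l f hf => absurd (Z.map f z.2) hf⟩
    · have h2 := (s₁.app m ⟨_, h⟩).2
      have h3 : (s₁.app m ⟨_, h⟩).1.1 = r₁.app m z.1 := app_congr hs ⟨_, h⟩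
      change pair (r₁.app m z.1) _ ∈ _
      rw [← h3]
      exact h2
    · obtain rfl : z' = Z.toSSet.map f z := Subtype.ext hz'
      exact hR.map f

theorem kanSub_glue (hA : KanSub A) (k k' : Fin 2) (r : Z.toSSet ⊗ Δ[1] ⟶ Z.toSSet)
    (hr : ept Z.toSSet k ≫ r = 𝟙 _) (hr' : ept Z.toSSet k' ≫ r = Z.ι ≫ r₁)
    (s : A.toSSet ⊗ Δ[1] ⟶ A.toSSet) (hs : ept A.toSSet k ≫ s = 𝟙 _)
    (hsp : s ≫ A.ι ≫ fst _ _ = (A.ι ≫ fst _ _) ▷ Δ[1] ≫ r) :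
    KanSub (glue r₁ (ept A.toSSet k' ≫ s)) := by
  classical
  rw [kanSub_iff]
  intro n i b c hc
  choose e he' using hc
  have he : ∀ m x, GlueRel r₁ (ept A.toSSet k' ≫ s) (b.app m x.1) (c.app m x) (e m x) := he'
  clear he'
  let eA : (horn (n + 1) i : SSet.{0}) ⟶ A.toSSet :=
    homMk (fun m x => ⟨pair (r₁.app m (b.app m x.1)) (e m x), (he m x).1⟩) fun {m l} f x => by
      refine Subtype.ext (Prod.ext ?_ ?_)
      · exact app_congr (rfl : b ≫ r₁ = b ≫ r₁) _ |>.trans (app_map (b ≫ r₁) f x.1)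
      · have h1 := (he m x).map f
        have h2 := he l ((horn (n + 1) i : SSet.{0}).map f x)
        rw [← app_map, ← app_map] at h1
        exact h2.unique h1
  let wZ : (Z.preimage b).toSSet ⟶ Z.toSSet := homMk (fun m x => ⟨b.app m x.1, x.2⟩)
    fun f x => Subtype.ext (app_map b f x.1)
  let u : (Z.preimage ((horn (n + 1) i).ι ≫ b)).toSSet ⟶ (Z.preimage b).toSSet :=
    homMk (fun m x => ⟨x.1.1, x.2⟩) fun f x => rfl
  have : Mono u := mono_of_injective fun m x y h =>
    Subtype.ext (Subtype.ext (congrArg (fun t => t.1) h : x.1.1 = y.1.1))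
  let a : (Z.preimage ((horn (n + 1) i).ι ≫ b)).toSSet ⟶ A.toSSet :=
    homMk (fun m x => ⟨pair ⟨b.app m x.1.1, x.2⟩ (c.app m x.1),
      ((he m x.1).fiberRel ⟨b.app m x.1.1, x.2⟩ rfl).1⟩) fun {m l} f x =>
      Subtype.ext (Prod.ext (Subtype.ext (app_map b f x.1.1)) (app_map c f x.1))
  have := hA n i
  obtain ⟨a', e', ha', hua, he', hie, hje⟩ := hA.exists_lift_deformation k k' Z.ι r r₁ hr hr'
    s hs hsp (horn (n + 1) i).ι (Z.preimage b).ι u (Z.preimage ((horn (n + 1) i).ι ≫ b)).ι rfl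
    (fun m x y hxy => by
      obtain ⟨x, hx⟩ := x
      obtain rfl : x = y.1 := hxy
      exact ⟨⟨y, hx⟩, rfl, rfl⟩) b wZ rfl eA rfl a rfl (by
      refine hom_ext_app fun m x => Subtype.ext (Prod.ext ?_ ?_)
      · have h1 : ((ept A.toSSet k' ≫ s) ≫ A.ι ≫ fst _ _) = (A.ι ≫ fst _ _) ≫ Z.ι ≫ r₁ := by
          rw [Category.assoc, hsp, ept_whiskerRight_assoc, hr']
        exact app_congr h1 (a.app m x)
      · exact ((he m x.1).fiberRel ⟨b.app m x.1.1, x.2⟩ rfl).2)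
  let c' : (Δ[n + 1] : SSet.{0}) ⟶ cofree S := toCofree fun m x =>
    if h : b.app m x ∈ Z.obj m then (a'.app m ⟨x, h⟩).1.2 m (𝟙 m) else (e'.app m x).1.2 m (𝟙 m)
  have hc'_app : ∀ m x, c'.app m x m (𝟙 m) = if h : b.app m x ∈ Z.obj m then
      (a'.app m ⟨x, h⟩).1.2 m (𝟙 m) else (e'.app m x).1.2 m (𝟙 m) := fun m x =>
    toCofree_app_id _ x
  have hc' : (Z.preimage b).ι ≫ c' = a' ≫ A.ι ≫ snd _ _ := by
    refine cofree_hom_ext fun m x => ?_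
    change c'.app m x.1 m (𝟙 m) = _
    rw [hc'_app, dif_pos (show b.app m x.1 ∈ Z.obj m from x.2)]
    rfl
  refine ⟨c', ?_, fun m x => ⟨_, glueRel_of_hom b c' (e' ≫ A.ι ≫ snd _ _) ?_ ?_ ?_ x⟩⟩
  · refine cofree_hom_ext fun m x => ?_
    change c'.app m x.1 m (𝟙 m) = _
    rw [hc'_app]
    split_ifs with h
    · exact congrArg (fun t : A.toSSet.obj m => t.1.2 m (𝟙 m)) (app_congr hua (⟨x, h⟩ :
        (Z.preimage ((horn (n + 1) i).ι ≫ b)).toSSet.obj m))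
    · refine (congrArg (fun t : A.toSSet.obj m => t.1.2 m (𝟙 m)) (app_congr hie x)).trans ?_
      exact ((he m x).eq_of_notMem h).symm
  · intro m x
    have h1 : (e'.app m x).1.1 = r₁.app m (b.app m x) := app_congr he' x
    rw [← h1]
    exact (e'.app m x).2
  · rintro m x ⟨z, hz⟩ h
    obtain rfl : z = b.app m x := h
    have h1 : (a'.app m ⟨x, hz⟩).1 =
        pair (⟨b.app m x, hz⟩ : Z.toSSet.obj m) (c'.app m x) :=
      Prod.ext (app_congr ha' (⟨x, hz⟩ : (Z.preimage b).toSSet.obj m))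
        (app_congr hc' (⟨x, hz⟩ : (Z.preimage b).toSSet.obj m)).symm
    have h2 : pair (⟨b.app m x, hz⟩ : Z.toSSet.obj m) (c'.app m x) ∈ A.obj m := by
      rw [← h1]
      exact (a'.app m ⟨x, hz⟩).2
    refine ⟨h2, ?_⟩
    obtain h3 : a'.app m ⟨x, hz⟩ = ⟨_, h2⟩ := Subtype.ext h1
    rw [← h3]
    have h4 : e'.app m x = (ept A.toSSet k' ≫ s).app m (a'.app m ⟨x, hz⟩) :=
      app_congr hje (⟨x, hz⟩ : (Z.preimage b).toSSet.obj m)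
    exact congrArg (fun t : A.toSSet.obj m => t.1.2) h4.symm
  · intro m x h
    rw [hc'_app, dif_neg h]
    rfl

/-- A Kan fibration over a strong deformation retract extends to the ambient simplicial set. -/
theorem KanSub.exists_extension (hA : KanSub A) (k k' : Fin 2) (r : Z.toSSet ⊗ Δ[1] ⟶ Z.toSSet)
    (hr : ept Z.toSSet k ≫ r = 𝟙 _) (hr' : ept Z.toSSet k' ≫ r = Z.ι ≫ r₁) :
    ∃ B : (W ⊗ cofree S).Subcomplex, KanSub B ∧ B.preimage (Z.ι ▷ cofree S) = A := by
  obtain ⟨s, hs, hsp⟩ := KanFibration.exists_lift_homotopy_abs hA k (𝟙 _)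
    ((A.ι ≫ fst _ _) ▷ Δ[1] ≫ r) (by
      rw [ept_whiskerRight_assoc, hr, Category.comp_id, Category.id_comp])
  refine ⟨_, kanSub_glue hA k k' r hr hr' s hs hsp, preimage_glue ?_⟩
  rw [Category.assoc, hsp, ept_whiskerRight_assoc, hr']

end Glue

section HornDeformation

/-- The homotopy of a standard simplex induced by a monotone map. -/
def simplexDeformation {N : ℕ} (ρ : Fin (N + 1) × Fin 2 →o Fin (N + 1)) :
    (Δ[N] ⊗ Δ[1] : SSet.{0}) ⟶ Δ[N] :=
  homMk (fun _ z => stdSimplex.objMk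
    (ρ.comp ((stdSimplex.asOrderHom z.1).prod (stdSimplex.asOrderHom z.2)))) fun _ _ => rfl

theorem asOrderHom_simplexDeformation {N : ℕ} (ρ : Fin (N + 1) × Fin 2 →o Fin (N + 1))
    {m : SimplexCategoryᵒᵖ} (x : (Δ[N] : SSet.{0}).obj m) (t : (Δ[1] : SSet.{0}).obj m)
    (j : Fin (m.unop.len + 1)) :
    stdSimplex.asOrderHom ((simplexDeformation ρ).app m (pair x t)) j =
      ρ (stdSimplex.asOrderHom x j, stdSimplex.asOrderHom t j) := rfl

theorem mem_horn_of_apply_ne {N : ℕ} {i a : Fin (N + 1)} (ha : a ≠ i) {m : SimplexCategoryᵒᵖ}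
    {x : (Δ[N] : SSet.{0}).obj m} (h : ∀ j, stdSimplex.asOrderHom x j ≠ a) :
    x ∈ (horn N i).obj m := by
  rw [mem_horn_iff, Set.ne_univ_iff_exists_notMem]
  refine ⟨a, ?_⟩
  rintro (⟨j, hj⟩ | hj)
  exacts [h j hj, ha hj]

theorem exists_apply_ne_of_mem_horn {N : ℕ} {i : Fin (N + 1)} {m : SimplexCategoryᵒᵖ}
    {x : (Δ[N] : SSet.{0}).obj m} (h : x ∈ (horn N i).obj m) :
    ∃ a, a ≠ i ∧ ∀ j, stdSimplex.asOrderHom x j ≠ a := by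
  rw [mem_horn_iff, Set.ne_univ_iff_exists_notMem] at h
  obtain ⟨a, ha⟩ := h
  exact ⟨a, fun h => ha (Or.inr h), fun j hj => ha (Or.inl ⟨j, hj⟩)⟩

theorem exists_deformation_of_orderHom {N : ℕ} (i : Fin (N + 1)) (k k' : Fin 2)
    (ρ : Fin (N + 1) × Fin 2 →o Fin (N + 1)) (hk : ∀ x, ρ (x, k) = x)
    (hi : ∀ x t, ρ (x, t) = x ∨ ρ (x, t) = i) {a : Fin (N + 1)} (ha : a ≠ i)
    (hk' : ∀ x, ρ (x, k') ≠ a) :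
    ∃ (r : (horn N i : SSet.{0}) ⊗ Δ[1] ⟶ (horn N i : SSet.{0}))
      (r₁ : (Δ[N] : SSet.{0}) ⟶ (horn N i : SSet.{0})),
      ept _ k ≫ r = 𝟙 _ ∧ ept _ k' ≫ r = (horn N i).ι ≫ r₁ := by
  refine ⟨Subcomplex.lift ((horn N i).ι ▷ Δ[1] ≫ simplexDeformation ρ) ?_,
    Subcomplex.lift (ept _ k' ≫ simplexDeformation ρ) ?_, ?_, ?_⟩
  · rintro m _ ⟨⟨x, t⟩, rfl⟩
    obtain ⟨b, hb, hx⟩ := exists_apply_ne_of_mem_horn x.2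
    refine mem_horn_of_apply_ne hb fun j => ?_
    refine (asOrderHom_simplexDeformation ρ x.1 t j).trans_ne ?_
    rcases hi (stdSimplex.asOrderHom x.1 j) (stdSimplex.asOrderHom t j) with h | h
    · rw [h]
      exact hx j
    · rw [h]
      exact hb.symm
  · rintro m _ ⟨x, rfl⟩
    exact mem_horn_of_apply_ne ha fun j => hk' _
  · refine hom_ext_app fun m x => Subtype.ext ?_
    apply stdSimplex.objEquiv.injective
    apply SimplexCategory.Hom.ext
    apply OrderHom.ext
    funext j
    exact hk _
  · rfl

theorem exists_horn_deformation (n : ℕ) (i : Fin (n + 2)) :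
    ∃ (k k' : Fin 2) (r : (horn (n + 1) i : SSet.{0}) ⊗ Δ[1] ⟶ (horn (n + 1) i : SSet.{0}))
      (r₁ : (Δ[n + 1] : SSet.{0}) ⟶ (horn (n + 1) i : SSet.{0})),
      ept _ k ≫ r = 𝟙 _ ∧ ept _ k' ≫ r = (horn (n + 1) i).ι ≫ r₁ := by
  by_cases hi : i = 0
  · subst hi
    refine ⟨1, 0, exists_deformation_of_orderHom 0 1 0
      ⟨fun z => if z.2 = 1 then z.1 else 0, ?_⟩ (fun x => rfl) (fun x t => ?_)
      (a := 1) (by simp) fun x => ?_⟩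
    · rintro ⟨x, s⟩ ⟨y, t⟩ ⟨h1, h2⟩
      dsimp at h1 h2 ⊢
      split_ifs with h3 h4
      · exact h1
      · exact absurd (by omega) h4
      · exact Fin.zero_le _
      · exact le_rfl
    · change (if t = 1 then x else 0) = x ∨ (if t = 1 then x else 0) = 0
      split_ifs <;> simp
    · change ¬ (if (0 : Fin 2) = 1 then x else 0) = 1
      simp
  · refine ⟨0, 1, exists_deformation_of_orderHom i 0 1
      ⟨fun z => if z.2 = 0 then z.1 else max z.1 i, ?_⟩ (fun x => rfl) (fun x t => ?_)
      (a := 0) (Ne.symm hi) fun x => ?_⟩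
    · rintro ⟨x, s⟩ ⟨y, t⟩ ⟨h1, h2⟩
      dsimp at h1 h2 ⊢
      split_ifs with h3 h4
      · exact h1
      · exact h1.trans (le_max_left _ _)
      · exact absurd (by omega) h3
      · exact max_le_max_right _ h1
    · change (if t = 0 then x else max x i) = x ∨ (if t = 0 then x else max x i) = i
      split_ifs
      · exact Or.inl rfl
      · exact max_choice _ _
    · intro h
      exact hi (le_antisymm ((le_max_right x i).trans h.le) (Fin.zero_le _))

end HornDeformation

section Universe

theorem kanComplex_univ (S : Type) : KanComplex (univ (cofree S)) := by
  refine fun n i => ⟨fun {χ b} sq => ?_⟩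
  obtain ⟨k, k', r, r₁, hr, hr'⟩ := exists_horn_deformation n i
  obtain ⟨B, hB, hBχ⟩ := (kanSub_tot χ).exists_extension k k' r hr hr'
  refine ⟨⟨⟨classify B hB, hom_univ_ext ?_, toPt_unique _ _⟩⟩⟩
  rw [tot_comp, tot_classify]
  exact hBχ

theorem KanSub.hasLiftingProperty {S : Type} {Y : SSet.{0}} {B : (Y ⊗ cofree S).Subcomplex}
    (hB : KanSub B) {M N : SSet.{0}} {j : M ⟶ N} [Mono j] (hj : WeakHomotopyEquivalence j) :
    HasLiftingProperty j (B.ι ≫ CartesianMonoidalCategory.fst Y (cofree S)) := by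
  have hjT := hj.hasLiftingProperty (kanSub_tot (𝟙 (univ (cofree S)))) (kanComplex_univ S)
  have hT := tot_comp (classify B hB) (𝟙 (univ (cofree S)))
  rw [Category.comp_id, tot_classify] at hT
  generalize classify B hB = χ at hT
  generalize tot (𝟙 (univ (cofree S))) = T at hT hjT
  subst hT
  refine ⟨fun {g b} sq => ?_⟩
  have sq' : CommSq (Subcomplex.lift (g ≫ (T.preimage (χ ▷ cofree S)).ι ≫ χ ▷ cofree S) (by
      rintro m _ ⟨x, rfl⟩
      exact (g.app m x).2)) j (T.ι ≫ CartesianMonoidalCategory.fst _ _) (b ≫ χ) :=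
    ⟨congrArg (fun f => f ≫ χ) sq.w⟩
  obtain ⟨⟨l, hl, hl'⟩⟩ := hjT.sq_hasLift sq'
  refine ⟨⟨⟨Subcomplex.lift (CartesianMonoidalCategory.lift b
    (l ≫ T.ι ≫ CartesianMonoidalCategory.snd _ _)) ?_, ?_, ?_⟩⟩⟩
  · rintro m _ ⟨x, rfl⟩
    have h : (l.app m x).1.1 = χ.app m (b.app m x) := app_congr hl' x
    have h2 := (l.app m x).2
    change ((χ.app m (b.app m x), (l.app m x).1.2) : _ × _) ∈ T.obj m
    rw [← h]
    exact h2
  · refine hom_ext_app fun m x => Subtype.ext (Prod.ext ?_ ?_)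
    · exact (app_congr sq.w x).symm
    · exact congrArg (fun t : T.toSSet.obj m => t.1.2) (app_congr hl x)
  · rfl

/-- A weak homotopy equivalence which is a monomorphism lifts against all Kan fibrations. -/
theorem WeakHomotopyEquivalence.hasLiftingProperty_kanFibration {M N : SSet.{0}} {j : M ⟶ N}
    [Mono j] (hj : WeakHomotopyEquivalence j) {X Y : SSet.{0}} {p : X ⟶ Y} (hp : KanFibration p) :
    HasLiftingProperty j p := by
  obtain ⟨S, ι, _, rfl⟩ : ∃ (S : Type) (ι : X ⟶ Y ⊗ cofree S), Mono ι ∧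
      ι ≫ CartesianMonoidalCategory.fst _ _ = p :=
    ⟨Σ m, X.obj m, CartesianMonoidalCategory.lift p (toCofree fun m x => ⟨m, x⟩),
      mono_lift_toCofree p _ fun _ _ _ _ h => sigma_mk_injective h, by simp⟩
  have : IsIso (Subcomplex.toRange ι) := by
    have : Mono (Subcomplex.toRange ι) :=
      mono_of_mono_fac (Subcomplex.toRange_ι ι)
    exact isIso_of_mono_of_epi _
  have hB : KanSub (Subcomplex.range ι) := by
    have hι : inv (Subcomplex.toRange ι) ≫ ι = (Subcomplex.range ι).ι := by
      rw [IsIso.inv_comp_eq, Subcomplex.toRange_ι]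
    have := (KanFibration.of_isIso (inv (Subcomplex.toRange ι))).comp hp
    rwa [reassoc_of% hι] at this
  have := hB.hasLiftingProperty hj
  rw [← Subcomplex.toRange_ι ι, Category.assoc]
  infer_instance

end Universe

section Main

theorem Homotopy.pre {X Y : SSet.{0}} {f g : X ⟶ Y} (h : Homotopy f g) (K : SSet.{0}) :
    Homotopy ((MonoidalClosed.pre f).app K) ((MonoidalClosed.pre g).app K) := by
  obtain ⟨H, rfl, rfl⟩ := h
  have key : ∀ k : Fin 2, ept _ k ≫ MonoidalClosed.curry
      (CartesianMonoidalCategory.lift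
        (CartesianMonoidalCategory.lift (CartesianMonoidalCategory.fst X _)
          (CartesianMonoidalCategory.snd X _ ≫ CartesianMonoidalCategory.snd _ _) ≫ H)
        (CartesianMonoidalCategory.snd X ((ihom Y).obj K ⊗ Δ[1]) ≫
          CartesianMonoidalCategory.fst _ _) ≫ (ihom.ev Y).app K) =
      (MonoidalClosed.pre (ept X k ≫ H)).app K := fun k => by
    apply MonoidalClosed.uncurry_injective
    rw [MonoidalClosed.uncurry_natural_left, MonoidalClosed.uncurry_curry]
    exact Eq.trans rfl (MonoidalClosed.uncurry_pre (ept X k ≫ H) K).symm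
  exact ⟨_, key 0, key 1⟩

theorem Homotopic.pre {X Y : SSet.{0}} {f g : X ⟶ Y} (h : Homotopic f g) (K : SSet.{0}) :
    Homotopic ((MonoidalClosed.pre f).app K) ((MonoidalClosed.pre g).app K) :=
  eqvGen_map (fun f => (MonoidalClosed.pre f).app K) (fun _ _ h => Homotopy.pre h K) h

theorem pre_comp_app {X Y Z : SSet.{0}} (f : X ⟶ Y) (g : Y ⟶ Z) (K : SSet.{0}) :
    (MonoidalClosed.pre (f ≫ g)).app K =
      (MonoidalClosed.pre g).app K ≫ (MonoidalClosed.pre f).app K := by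
  rw [MonoidalClosed.pre_map, NatTrans.comp_app]

theorem pre_id_app (X K : SSet.{0}) :
    (MonoidalClosed.pre (𝟙 X)).app K = 𝟙 _ := by
  rw [MonoidalClosed.pre_id, NatTrans.id_app]

theorem HomotopyEquivalence.weakHomotopyEquivalence {X Y : SSet.{0}} {f : X ⟶ Y}
    (hf : HomotopyEquivalence f) : WeakHomotopyEquivalence f := fun K _ => by
  obtain ⟨g, h1, h2⟩ := hf
  refine ⟨(MonoidalClosed.pre g).app K, ?_, ?_⟩
  · simpa only [pre_comp_app, pre_id_app] using h2.pre K
  · simpa only [pre_comp_app, pre_id_app] using h1.pre K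

theorem TrivialFibration.kanFibration {X Y : SSet.{0}} {p : X ⟶ Y} (hp : TrivialFibration p) :
    KanFibration p := fun _ _ => hp.hasLiftingProperty _

theorem TrivialFibration.homotopyEquivalence {X Y : SSet.{0}} {p : X ⟶ Y}
    (hp : TrivialFibration p) : HomotopyEquivalence p := by
  obtain ⟨t, ht⟩ : ∃ t, t ≫ p = 𝟙 Y := by
    have := hp.hasLiftingProperty (⊥ : Y.Subcomplex).ι
    let g : (⊥ : Y.Subcomplex).toSSet ⟶ X := homMk (fun _ x => x.2.elim) fun _ x => x.2.elim
    have sq : CommSq g (⊥ : Y.Subcomplex).ι p (𝟙 Y) := ⟨hom_ext_app fun _ x => x.2.elim⟩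
    exact ⟨sq.lift, sq.fac_right⟩
  let e : Fin 2 → (X ⟶ X) := fun k => if k = 0 then p ≫ t else 𝟙 X
  obtain ⟨h, hh⟩ := exists_glue (fun k => ept X k) e _ le_rfl (by
    intro a b m x y hxy
    rw [ept_app, ept_app, pair_inj] at hxy
    obtain ⟨rfl, hab⟩ := hxy
    fin_cases a <;> fin_cases b
    · rfl
    · exact absurd hab (const_zero_ne_one m)
    · exact absurd hab.symm (const_zero_ne_one m)
    · rfl)
  have := hp.hasLiftingProperty (unionRange fun k => ept X k).ι
  have he : ∀ k, e k ≫ p = p := by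
    intro k
    dsimp only [e]
    split_ifs
    · rw [Category.assoc, ht, Category.comp_id]
    · rw [Category.id_comp]
  have sq : CommSq h (unionRange fun k => ept X k).ι p
      (CartesianMonoidalCategory.fst X Δ[1] ≫ p) := ⟨hom_ext_app fun m z => by
    obtain ⟨_, k, x, rfl⟩ := z
    exact (congrArg (p.app m) (hh k m x _)).trans (app_congr (he k) x)⟩
  have hk : ∀ k, ept X k ≫ sq.lift = e k := fun k => hom_ext_app fun m x =>
    (app_congr sq.fac_left ⟨(ept X k).app m x, k, x, rfl⟩).trans (hh k m x _)
  exact ⟨t, .rel _ _ ⟨sq.lift, hk 0, hk 1⟩, ht ▸ .refl _⟩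

theorem HomotopyEquivalence.of_comp_right {X Y Z : SSet.{0}} {f : X ⟶ Y} {g : Y ⟶ Z}
    (hf : HomotopyEquivalence f) (hfg : HomotopyEquivalence (f ≫ g)) : HomotopyEquivalence g := by
  obtain ⟨f', hf1, hf2⟩ := hf
  obtain ⟨l, h1, h2⟩ := hfg
  refine ⟨l ≫ f, ?_, ?_⟩
  · have a := (h1.comp_right f).comp_left f'
    have b : Homotopic _ _ := Homotopic.comp_right (hf2.symm _ _) (g ≫ l ≫ f)
    simp only [Category.assoc, Category.id_comp] at a b
    exact (b.trans _ _ _ a).trans _ _ _ hf2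
  · simpa only [Category.assoc] using h2

theorem TrivialFibration.of_retract {X Y Z : SSet.{0}} {p : X ⟶ Y} {q : Z ⟶ Y} {j : X ⟶ Z}
    {l : Z ⟶ X} (hq : TrivialFibration q) (hjl : j ≫ l = 𝟙 X) (hj : j ≫ q = p) (hl : l ≫ p = q) :
    TrivialFibration p := fun n => ⟨fun {g b} sq => by
  have := hq n
  have sq' : CommSq (g ≫ j) (SSet.boundary n).ι q b := ⟨by rw [Category.assoc, hj, sq.w]⟩
  exact ⟨⟨⟨sq'.lift ≫ l, by rw [sq'.fac_left_assoc, Category.assoc, hjl, Category.comp_id],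
    by rw [Category.assoc, hl, sq'.fac_right]⟩⟩⟩⟩

end Main

end Paper

/-- A map of simplicial sets is a trivial fibration iff it is a
Kan fibration and a weak homotopy equivalence. -/
theorem trivialFibration_iff {X Y : SSet.{0}} (p : X ⟶ Y) :
    Paper.TrivialFibration p ↔
      (Paper.KanFibration p ∧ Paper.WeakHomotopyEquivalence p) := by
  refine ⟨fun hp => ⟨hp.kanFibration, hp.homotopyEquivalence.weakHomotopyEquivalence⟩,
    fun ⟨hp, hw⟩ => ?_⟩
  obtain ⟨Z, j, q, _, hq, hjq⟩ := Paper.exists_factorization p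
  have hj : Paper.WeakHomotopyEquivalence j := fun K hK =>
    (hq.homotopyEquivalence.weakHomotopyEquivalence K hK).of_comp_right (by
      rw [← Paper.pre_comp_app, hjq]
      exact hw K hK)
  have := hj.hasLiftingProperty_kanFibration hp
  have sq : CommSq (𝟙 X) j p q := ⟨by rw [Category.id_comp, hjq]⟩
  exact hq.of_retract sq.fac_left hjq sq.fac_right
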